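/- arXiv:0907.3295 — 3 statements merged into one kernel-verified Lean document; each statement's English description precedes it below -/
import Mathlib

section
/- Let f : H → L¹ be a Lipschitz map with respect to the Carnot–Carathéodory distance d, and let exp(tZ) = (0,0,t) denote the central one-parameter subgroup. Then for Lebesgue-almost every p ∈ H, liminf_{t→0} ‖f(p) − f(p·exp(tZ))‖₁ / d(p, p·exp(tZ)) = 0. -/
open MeasureTheory Set Topology Filter

noncomputable section

/-- The Heisenberg group as a set: `ℝ³`. -/
abbrev Heis : Type := ℝ × ℝ × ℝ

/-- The Heisenberg group multiplication
`(a,b,c)·(a',b',c') = (a+a', b+b', c+c'+a·b')`. -/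
def hMul (x y : Heis) : Heis :=
  (x.1 + y.1, x.2.1 + y.2.1, x.2.2 + y.2.2 + x.1 * y.2.1)

/-- The abelianization homomorphism `π : H → ℝ²`, `π(a,b,c) = (a,b)`. -/
def hPi (x : Heis) : ℝ × ℝ := (x.1, x.2.1)

/-- A Lipschitz path `c : [0,1] → H` is horizontal with (a.e.) component derivatives
`v₁, v₂` if `c₁' = v₁`, `c₂' = v₂` and `c₃'(t) = c₁(t)·c₂'(t)` hold almost everywhere
on `[0,1]`. -/
def IsHorizPath (c : ℝ → Heis) (v₁ v₂ : ℝ → ℝ) : Prop :=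
  ∀ᵐ t ∂(volume : Measure ℝ), t ∈ Icc (0 : ℝ) 1 →
    HasDerivAt (fun u => (c u).1) (v₁ t) t ∧
    HasDerivAt (fun u => (c u).2.1) (v₂ t) t ∧
    HasDerivAt (fun u => (c u).2.2) ((c t).1 * v₂ t) t

/-- The length `∫₀¹ √(c₁'(t)² + c₂'(t)²) dt` of a horizontal path. -/
def pathLen (v₁ v₂ : ℝ → ℝ) : ℝ :=
  ∫ t in (0 : ℝ)..1, Real.sqrt (v₁ t ^ 2 + v₂ t ^ 2)

/-- The Carnot–Carathéodory distance on the Heisenberg group: the infimum of lengths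
of Lipschitz horizontal paths joining the two points. -/
def ccDist (x y : Heis) : ℝ :=
  sInf { l : ℝ | ∃ c : ℝ → Heis, ∃ v₁ v₂ : ℝ → ℝ,
    (∃ K : NNReal, LipschitzOnWith K c (Icc 0 1)) ∧
    IsHorizPath c v₁ v₂ ∧
    IntervalIntegrable (fun t => Real.sqrt (v₁ t ^ 2 + v₂ t ^ 2)) volume 0 1 ∧
    c 0 = x ∧ c 1 = y ∧ l = pathLen v₁ v₂ }

/-- The horizontal element `exp (v₁ X + v₂ Y)`. -/
def hExp (v : ℝ × ℝ) : Heis := (v.1, v.2, v.1 * v.2 / 2)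

/-- The central element `exp (t Z)`. -/
def hCen (t : ℝ) : Heis := (0, 0, t)

/-- The inverse in the Heisenberg group. -/
def hInv (g : Heis) : Heis := (-g.1, -g.2.1, -g.2.2 + g.1 * g.2.1)

/-- The `ℓ¹` size of an element of the Heisenberg group. -/
def hSize (g : Heis) : ℝ := |g.1| + |g.2.1| + |g.2.2|

/-- The `ℓ¹` size of a planar vector. -/
def vSize (v : ℝ × ℝ) : ℝ := |v.1| + |v.2|

lemma hSize_nonneg (g : Heis) : 0 ≤ hSize g := by unfold hSize; positivity

lemma vSize_nonneg (v : ℝ × ℝ) : 0 ≤ vSize v := by unfold vSize; positivity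

lemma vSize_smul (c : ℝ) (v : ℝ × ℝ) : vSize (c • v) = |c| * vSize v := by
  simp [vSize, abs_mul]; ring

lemma hExp_zero : hExp 0 = 0 := by simp [hExp]

lemma hMul_hInv (g : Heis) : hMul g (hInv g) = 0 := by
  ext <;> simp [hMul, hInv]

lemma hInv_hMul (g : Heis) : hMul (hInv g) g = 0 := by
  ext <;> simp [hMul, hInv]

lemma hMul_assoc (a b c : Heis) : hMul (hMul a b) c = hMul a (hMul b c) := by
  ext <;> simp [hMul] <;> ring

lemma hInv_hExp (v : ℝ × ℝ) : hInv (hExp v) = hExp (-v) := by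
  ext <;> simp [hExp, hInv]; ring

lemma hInv_hCen (t : ℝ) : hInv (hCen t) = hCen (-t) := by
  ext <;> simp [hCen, hInv]

lemma hMul_hExp_hExp (v w : ℝ × ℝ) :
    hMul (hExp v) (hExp w) = hMul (hExp (v + w)) (hCen ((v.1 * w.2 - v.2 * w.1) / 2)) := by
  ext <;> simp [hExp, hMul, hCen]; ring

lemma hMul_hExp_smul (v : ℝ × ℝ) (r s : ℝ) :
    hMul (hExp (r • v)) (hExp (s • v)) = hExp ((r + s) • v) := by
  ext <;> simp [hExp, hMul] <;> ring

lemma hSize_hExp_smul_le {h : ℝ} (hh : |h| ≤ 1) (v : ℝ × ℝ) :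
    hSize (hExp (h • v)) ≤ |h| * (vSize v + vSize v ^ 2) := by
  have h1 : |h * v.1 * (h * v.2) / 2| ≤ |h| * vSize v ^ 2 := by
    have : |h * v.1 * (h * v.2) / 2| = |h| * (|h| * (|v.1| * |v.2|) / 2) := by
      rw [abs_div, abs_mul, abs_mul, abs_mul]; norm_num; ring
    rw [this]
    have h2 : |h| * (|v.1| * |v.2|) ≤ 1 * (|v.1| * |v.2|) := by gcongr
    gcongr
    unfold vSize
    nlinarith [abs_nonneg v.1, abs_nonneg v.2, sq_nonneg (|v.1|), sq_nonneg (|v.2|)]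
  simp only [hSize, hExp, Prod.smul_fst, Prod.smul_snd, smul_eq_mul]
  rw [mul_add, vSize, mul_add, ← abs_mul, ← abs_mul]
  exact add_le_add le_rfl h1

/-- A measurable, measure preserving right action of the Heisenberg group. -/
structure HeisAction {X : Type*} [MeasurableSpace X] (μ : Measure X) where
  /-- the action map -/
  act : X → Heis → X
  measurable_act : Measurable (fun q : X × Heis => act q.1 q.2)
  act_act : ∀ x g h, act (act x g) h = act x (hMul g h)
  act_zero : ∀ x, act x 0 = x
  measurePreserving : ∀ g, MeasurePreserving (fun x => act x g) μ μ

namespace HeisAction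

variable {X : Type*} [MeasurableSpace X] {μ : Measure X} (S : HeisAction μ)

lemma act_hInv_act (x : X) (g : Heis) : S.act (S.act x g) (hInv g) = x := by
  rw [S.act_act, hMul_hInv, S.act_zero]

lemma act_act_hInv (x : X) (g : Heis) : S.act (S.act x (hInv g)) g = x := by
  rw [S.act_act, hInv_hMul, S.act_zero]

lemma measurable_act_right (g : Heis) : Measurable (fun x => S.act x g) :=
  (S.measurePreserving g).measurable

/-- The action of a group element as a measurable equivalence. -/
def equiv (g : Heis) : X ≃ᵐ X where
  toFun x := S.act x g
  invFun x := S.act x (hInv g)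
  left_inv x := S.act_hInv_act x g
  right_inv x := S.act_act_hInv x g
  measurable_toFun := S.measurable_act_right g
  measurable_invFun := S.measurable_act_right (hInv g)

lemma integral_act (g : Heis) (F : X → ℝ) : ∫ x, F (S.act x g) ∂μ = ∫ x, F x ∂μ :=
  (S.measurePreserving g).integral_comp (S.equiv g).measurableEmbedding F

lemma integrable_act (g : Heis) {F : X → ℝ} (hF : Integrable F μ) :
    Integrable (fun x => F (S.act x g)) μ :=
  (S.measurePreserving g).integrable_comp_of_integrable hF

/-- The increment of a function under a group element. -/
def incr (u : X → ℝ) (g : Heis) (x : X) : ℝ := u (S.act x g) - u x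

/-- The `L¹` size of the increment of a function under a group element. -/
def osc (u : X → ℝ) (g : Heis) : ℝ := ∫ x, |S.incr u g x| ∂μ

variable {S} {u w : X → ℝ}

lemma osc_nonneg (g : Heis) : 0 ≤ S.osc u g := integral_nonneg fun _ => abs_nonneg _

lemma integrable_incr (hu : Integrable u μ) (g : Heis) : Integrable (S.incr u g) μ :=
  (S.integrable_act g hu).sub hu

lemma measurable_incr (hu : Measurable u) (g : Heis) : Measurable (S.incr u g) :=
  (hu.comp (S.measurable_act_right g)).sub hu

lemma incr_hMul (g h : Heis) (x : X) :
    S.incr u (hMul g h) x = S.incr u g x + S.incr u h (S.act x g) := by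
  simp [incr, S.act_act]

lemma osc_hMul_le (hu : Integrable u μ) (g h : Heis) :
    S.osc u (hMul g h) ≤ S.osc u g + S.osc u h := by
  unfold osc
  rw [← S.integral_act g (fun x => |S.incr u h x|), ← integral_add (integrable_incr hu g).abs
    (S.integrable_act g (integrable_incr hu h).abs)]
  refine integral_mono (integrable_incr hu _).abs ((integrable_incr hu g).abs.add
    (S.integrable_act g (integrable_incr hu h).abs)) fun x => ?_
  simp only [incr_hMul]
  exact abs_add_le _ _

lemma osc_hInv (g : Heis) : S.osc u (hInv g) = S.osc u g := by
  unfold osc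
  rw [← S.integral_act g (fun x => |S.incr u (hInv g) x|)]
  refine integral_congr_ae (ae_of_all _ fun x => ?_)
  simp only [incr, S.act_hInv_act]
  exact abs_sub_comm _ _

variable (S) in
/-- Functions whose right translates by small elements are close to them in `L¹`. -/
def TransCont (w : X → ℝ) : Prop :=
  ∀ ε > 0, ∃ ρ > 0, ∀ g, hSize g ≤ ρ → S.osc w g ≤ ε

variable (S) in
/-- Integrable functions that are Lipschitz in `L¹` along the horizontal directions. -/
structure HorizLip (u : X → ℝ) (M : ℝ) : Prop where
  nonneg : 0 ≤ M
  measurable : Measurable u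
  integrable : Integrable u μ
  osc_le : ∀ v, S.osc u (hExp v) ≤ M * vSize v

variable {M : ℝ}

lemma HorizLip.osc_hCen_sq_le (hu : S.HorizLip u M) {s : ℝ} (hs : 0 ≤ s) :
    S.osc u (hCen (s ^ 2)) ≤ 4 * M * s := by
  have h : hCen (s ^ 2) = hMul (hMul (hMul (hExp (s, 0)) (hExp (0, s))) (hExp (-s, 0)))
      (hExp (0, -s)) := by
    ext <;> simp [hCen, hMul, hExp]; ring
  rw [h]
  have h1 := osc_hMul_le (S := S) hu.integrable (hMul (hMul (hExp (s, 0)) (hExp (0, s)))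
    (hExp (-s, 0))) (hExp (0, -s))
  have h2 := osc_hMul_le (S := S) hu.integrable (hMul (hExp (s, 0)) (hExp (0, s)))
    (hExp (-s, 0))
  have h3 := osc_hMul_le (S := S) hu.integrable (hExp (s, 0)) (hExp (0, s))
  have e1 := hu.osc_le (s, 0)
  have e2 := hu.osc_le (0, s)
  have e3 := hu.osc_le (-s, 0)
  have e4 := hu.osc_le (0, -s)
  simp only [vSize, abs_zero, add_zero, zero_add, abs_neg, abs_of_nonneg hs] at e1 e2 e3 e4
  linarith

lemma HorizLip.osc_hCen_le (hu : S.HorizLip u M) (t : ℝ) :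
    S.osc u (hCen t) ≤ 4 * M * √|t| := by
  rcases le_total 0 t with ht | ht
  · have := hu.osc_hCen_sq_le (Real.sqrt_nonneg |t|)
    rw [Real.sq_sqrt (abs_nonneg _), abs_of_nonneg ht] at this
    rwa [abs_of_nonneg ht]
  · have := hu.osc_hCen_sq_le (Real.sqrt_nonneg |t|)
    rw [Real.sq_sqrt (abs_nonneg _), abs_of_nonpos ht, ← hInv_hCen, osc_hInv] at this
    rwa [abs_of_nonpos ht]

lemma hMul_hExp_hCen (g : Heis) :
    g = hMul (hExp (g.1, g.2.1)) (hCen (g.2.2 - g.1 * g.2.1 / 2)) := by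
  ext <;> simp [hMul, hExp, hCen]

lemma HorizLip.osc_le' (hu : S.HorizLip u M) (g : Heis) :
    S.osc u g ≤ M * (|g.1| + |g.2.1|) + 4 * M * √|g.2.2 - g.1 * g.2.1 / 2| := by
  have h := osc_hMul_le (S := S) hu.integrable (hExp (g.1, g.2.1))
    (hCen (g.2.2 - g.1 * g.2.1 / 2))
  rw [← hMul_hExp_hCen] at h
  exact h.trans (add_le_add (hu.osc_le _) (hu.osc_hCen_le _))

lemma HorizLip.transCont (hu : S.HorizLip u M) : S.TransCont u := by
  intro ε hε
  have hcont : Continuous fun g : Heis =>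
      M * (|g.1| + |g.2.1|) + 4 * M * √|g.2.2 - g.1 * g.2.1 / 2| := by fun_prop
  have h0 := hcont.tendsto 0
  simp only [Prod.fst_zero, abs_zero, Prod.snd_zero, add_zero, mul_zero, zero_div, sub_zero,
    Real.sqrt_zero] at h0
  obtain ⟨ρ, hρ, h⟩ := Metric.eventually_nhds_iff.1 (h0.eventually (gt_mem_nhds hε))
  refine ⟨ρ / 2, by positivity, fun g hg => (hu.osc_le' g).trans (h ?_).le⟩
  have e1 := abs_nonneg g.1
  have e2 := abs_nonneg g.2.1
  have e3 := abs_nonneg g.2.2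
  unfold hSize at hg
  rw [dist_zero_right, Prod.norm_def, Prod.norm_def]
  simp only [Real.norm_eq_abs]
  refine max_lt (by linarith) (max_lt (by linarith) (by linarith))

/-- Translates of functions with the continuity property have it as well. -/
lemma TransCont.incr (hu : S.TransCont u) (hint : Integrable u μ) (k : Heis) :
    S.TransCont (S.incr u k) := by
  intro ε hε
  obtain ⟨ρ, hρ, h⟩ := hu (ε / 2) (by positivity)
  set c : ℝ := 1 + |k.1| + |k.2.1|
  have hc : 0 < c := by positivity
  have hc1 : 1 ≤ c := by
    have := abs_nonneg k.1; have := abs_nonneg k.2.1; simp only [c]; linarith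
  refine ⟨ρ / c, by positivity, fun g hg => ?_⟩
  have hconj : hSize (hMul (hInv k) (hMul g k)) ≤ ρ := by
    have h1 : hSize (hMul (hInv k) (hMul g k)) ≤ c * hSize g := by
      have e : hMul (hInv k) (hMul g k) = (g.1, g.2.1, g.2.2 + g.1 * k.2.1 - k.1 * g.2.1) := by
        ext <;> simp [hMul, hInv]; ring
      have e1 : |g.2.2 + g.1 * k.2.1 - k.1 * g.2.1| ≤ |g.2.2| + |g.1| * |k.2.1|
          + |k.1| * |g.2.1| := by
        rw [← abs_mul, ← abs_mul]
        exact (abs_sub _ _).trans (add_le_add (abs_add_le _ _) le_rfl)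
      rw [e]
      simp only [hSize, c]
      nlinarith [mul_nonneg (abs_nonneg k.1) (abs_nonneg g.1),
        mul_nonneg (abs_nonneg k.2.1) (abs_nonneg g.2.1),
        mul_nonneg (abs_nonneg k.1) (abs_nonneg g.2.2),
        mul_nonneg (abs_nonneg k.2.1) (abs_nonneg g.2.2)]
    calc _ ≤ _ := h1
      _ ≤ c * (ρ / c) := by gcongr
      _ = ρ := by field_simp
  have hg' : hSize g ≤ ρ := hg.trans (div_le_self hρ.le hc1)
  have h1 := h _ hconj
  have h2 := h _ hg'
  have h3 : S.osc (S.incr u k) g ≤ S.osc u (hMul (hInv k) (hMul g k)) + S.osc u g := by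
    unfold osc
    rw [← S.integral_act k (fun x => |S.incr u (hMul (hInv k) (hMul g k)) x|),
      ← integral_add (S.integrable_act k (integrable_incr hint _).abs)
      (integrable_incr hint g).abs]
    refine integral_mono (integrable_incr (integrable_incr hint _) _).abs
      ((S.integrable_act k (integrable_incr hint _).abs).add (integrable_incr hint g).abs)
      fun x => ?_
    have : S.incr (S.incr u k) g x
        = S.incr u (hMul (hInv k) (hMul g k)) (S.act x k) - S.incr u g x := by
      simp only [HeisAction.incr, S.act_act, ← hMul_assoc, hMul_hInv]
      have : hMul 0 g = g := by ext <;> simp [hMul]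
      rw [this]; ring
    simp only [this]
    exact abs_sub _ _
  linarith

end HeisAction

namespace HeisAction

variable {X : Type*} [MeasurableSpace X] {μ : Measure X} {S : HeisAction μ}

variable (S) in
/-- Bounded measurable functions that are Lipschitz along the action. -/
structure IsTest (φ : X → ℝ) : Prop where
  measurable : Measurable φ
  bdd : ∃ B, 0 ≤ B ∧ ∀ x, |φ x| ≤ B
  lip : ∃ K, 0 ≤ K ∧ ∀ x g, |φ (S.act x g) - φ x| ≤ K * hSize g

variable {φ ψ w : X → ℝ}

lemma IsTest.const (c : ℝ) : S.IsTest fun _ => c where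
  measurable := measurable_const
  bdd := ⟨|c|, abs_nonneg c, fun _ => le_rfl⟩
  lip := ⟨0, le_rfl, fun _ _ => by simp⟩

lemma IsTest.add (hφ : S.IsTest φ) (hψ : S.IsTest ψ) : S.IsTest fun x => φ x + ψ x := by
  obtain ⟨B, hB, h1⟩ := hφ.bdd
  obtain ⟨B', hB', h2⟩ := hψ.bdd
  obtain ⟨K, hK, h3⟩ := hφ.lip
  obtain ⟨K', hK', h4⟩ := hψ.lip
  refine ⟨hφ.measurable.add hψ.measurable, ⟨B + B', by positivity, fun x =>
    (abs_add_le _ _).trans (add_le_add (h1 x) (h2 x))⟩, ⟨K + K', by positivity, fun x g => ?_⟩⟩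
  rw [add_sub_add_comm, add_mul]
  exact (abs_add_le _ _).trans (add_le_add (h3 x g) (h4 x g))

lemma IsTest.mul (hφ : S.IsTest φ) (hψ : S.IsTest ψ) : S.IsTest fun x => φ x * ψ x := by
  obtain ⟨B, hB, h1⟩ := hφ.bdd
  obtain ⟨B', hB', h2⟩ := hψ.bdd
  obtain ⟨K, hK, h3⟩ := hφ.lip
  obtain ⟨K', hK', h4⟩ := hψ.lip
  refine ⟨hφ.measurable.mul hψ.measurable, ⟨B * B', by positivity, fun x => ?_⟩,
    ⟨B * K' + K * B', by positivity, fun x g => ?_⟩⟩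
  · rw [abs_mul]
    exact mul_le_mul (h1 x) (h2 x) (abs_nonneg _) hB
  · have e : φ (S.act x g) * ψ (S.act x g) - φ x * ψ x
        = φ (S.act x g) * (ψ (S.act x g) - ψ x) + (φ (S.act x g) - φ x) * ψ x := by ring
    rw [e]
    refine (abs_add_le _ _).trans ?_
    rw [abs_mul, abs_mul]
    have := mul_le_mul (h1 (S.act x g)) (h4 x g) (abs_nonneg _) hB
    have := mul_le_mul (h3 x g) (h2 x) (abs_nonneg _) (mul_nonneg hK (hSize_nonneg g))
    nlinarith

lemma IsTest.const_mul (hφ : S.IsTest φ) (c : ℝ) : S.IsTest fun x => c * φ x :=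
  (IsTest.const c).mul hφ

lemma IsTest.sub (hφ : S.IsTest φ) (hψ : S.IsTest ψ) : S.IsTest fun x => φ x - ψ x := by
  simpa [sub_eq_add_neg] using hφ.add (hψ.const_mul (-1))

lemma IsTest.sum {ι : Type*} (s : Finset ι) {φ : ι → X → ℝ} (hφ : ∀ i ∈ s, S.IsTest (φ i)) :
    S.IsTest fun x => ∑ i ∈ s, φ i x := by
  classical
  induction s using Finset.induction_on with
  | empty => simpa using IsTest.const 0
  | insert i s hi ih =>
    simp only [Finset.sum_insert hi]
    exact (hφ i (Finset.mem_insert_self _ _)).add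
      (ih fun j hj => hφ j (Finset.mem_insert_of_mem hj))

lemma integrable_mul_of_bdd {B : ℝ} (hψ : Measurable ψ) (hB : ∀ x, |ψ x| ≤ B)
    (hw : Integrable w μ) : Integrable (fun x => ψ x * w x) μ :=
  hw.bdd_mul hψ.aestronglyMeasurable (ae_of_all _ hB)

lemma IsTest.integrable_mul (hφ : S.IsTest φ) (hw : Integrable w μ) :
    Integrable (fun x => φ x * w x) μ := by
  obtain ⟨B, -, hB⟩ := hφ.bdd
  exact integrable_mul_of_bdd hφ.measurable hB hw

lemma abs_integral_mul_le {B : ℝ} (hψ : Measurable ψ) (hB : ∀ x, |ψ x| ≤ B)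
    (hw : Integrable w μ) : |∫ x, ψ x * w x ∂μ| ≤ B * ∫ x, |w x| ∂μ := by
  refine (abs_integral_le_integral_abs).trans ?_
  rw [← integral_const_mul]
  refine integral_mono (integrable_mul_of_bdd hψ hB hw).abs (hw.abs.const_mul B) fun x => ?_
  simp only [abs_mul]
  exact mul_le_mul_of_nonneg_right (hB x) (abs_nonneg _)

lemma integral_act_mul (g : Heis) (ψ w : X → ℝ) :
    ∫ x, ψ (S.act x (hInv g)) * w x ∂μ = ∫ x, ψ x * w (S.act x g) ∂μ := by
  rw [← S.integral_act g (fun x => ψ (S.act x (hInv g)) * w x)]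
  refine integral_congr_ae (ae_of_all _ fun x => ?_)
  change ψ (S.act (S.act x g) (hInv g)) * w (S.act x g) = ψ x * w (S.act x g)
  rw [S.act_hInv_act]

lemma TransCont.test_mul (hw : S.TransCont w) (hint : Integrable w μ) (hφ : S.IsTest φ) :
    S.TransCont fun x => φ x * w x := by
  intro ε hε
  obtain ⟨B, hB0, hB⟩ := hφ.bdd
  obtain ⟨K, hK0, hK⟩ := hφ.lip
  set I := ∫ x, |w x| ∂μ
  have hI : 0 ≤ I := integral_nonneg fun _ => abs_nonneg _
  obtain ⟨ρ, hρ, h⟩ := hw (ε / (2 * (B + 1))) (by positivity)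
  refine ⟨min ρ (ε / (2 * (K * I + 1))), by positivity, fun g hg => ?_⟩
  have h1 := h g (hg.trans (min_le_left _ _))
  have h2 := hg.trans (min_le_right _ _)
  have h3 : S.osc (fun x => φ x * w x) g ≤ B * S.osc w g + K * hSize g * I := by
    unfold osc
    rw [← integral_const_mul, ← integral_const_mul, ← integral_add
      ((integrable_incr hint g).abs.const_mul _) (hint.abs.const_mul _)]
    refine integral_mono (integrable_incr (hφ.integrable_mul hint) g).abs
      (((integrable_incr hint g).abs.const_mul _).add (hint.abs.const_mul _)) fun x => ?_
    have e : S.incr (fun x => φ x * w x) g x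
        = φ (S.act x g) * S.incr w g x + (φ (S.act x g) - φ x) * w x := by
      simp only [HeisAction.incr]; ring
    simp only [e]
    refine (abs_add_le _ _).trans ?_
    rw [abs_mul, abs_mul]
    exact add_le_add (mul_le_mul_of_nonneg_right (hB _) (abs_nonneg _))
      (mul_le_mul_of_nonneg_right (hK _ _) (abs_nonneg _))
  have h4 : B * S.osc w g ≤ ε / 2 := by
    calc B * S.osc w g ≤ (B + 1) * (ε / (2 * (B + 1))) := by
          gcongr
          · exact osc_nonneg g
          · linarith
      _ = ε / 2 := by field_simp
  have h5 : K * hSize g * I ≤ ε / 2 := by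
    calc K * hSize g * I = (K * I) * hSize g := by ring
      _ ≤ (K * I + 1) * (ε / (2 * (K * I + 1))) := by
          gcongr
          · exact hSize_nonneg g
          · linarith
      _ = ε / 2 := by
        have : K * I + 1 ≠ 0 := by positivity
        field_simp
  linarith

variable (S) in
/-- The average of a function along a curve in the Heisenberg group. -/
def avg (γ : ℝ → Heis) (ψ : X → ℝ) (x : X) : ℝ := ∫ r in Ioc (0 : ℝ) 1, ψ (S.act x (γ r))

variable {γ : ℝ → Heis} {B : ℝ}

lemma measurable_act_curve (hγ : Measurable γ) (hψ : Measurable ψ) :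
    Measurable fun q : X × ℝ => ψ (S.act q.1 (γ q.2)) :=
  hψ.comp (S.measurable_act.comp (measurable_fst.prodMk (hγ.comp measurable_snd)))

lemma measurable_avg (hγ : Measurable γ) (hψ : Measurable ψ) : Measurable (S.avg γ ψ) := by
  have h := (measurable_act_curve (S := S) hγ hψ).stronglyMeasurable
  exact (StronglyMeasurable.integral_prod_right (f := fun x r => ψ (S.act x (γ r)))
    (ν := volume.restrict (Ioc (0 : ℝ) 1)) h).measurable

lemma integrable_act_curve (hγ : Measurable γ) (hψ : Measurable ψ) (hB : ∀ x, |ψ x| ≤ B)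
    (x : X) : IntegrableOn (fun r => ψ (S.act x (γ r))) (Ioc 0 1) := by
  refine Integrable.of_bound (C := B) ?_ (ae_of_all _ fun r => hB _)
  exact ((measurable_act_curve (S := S) hγ hψ).comp
    (measurable_const.prodMk measurable_id)).aestronglyMeasurable

lemma abs_avg_sub_le (hγ : Measurable γ) (hψ : Measurable ψ) (hB : ∀ x, |ψ x| ≤ B)
    {x : X} {c δ : ℝ} (h : ∀ r ∈ Ioc (0 : ℝ) 1, |ψ (S.act x (γ r)) - c| ≤ δ) :
    |S.avg γ ψ x - c| ≤ δ := by
  have e : S.avg γ ψ x - c = ∫ r in Ioc (0 : ℝ) 1, (ψ (S.act x (γ r)) - c) := by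
    rw [integral_sub (integrable_act_curve hγ hψ hB x) (integrable_const c)]
    simp [avg]
  rw [e]
  have := norm_setIntegral_le_of_norm_le_const (μ := volume) (s := Ioc (0 : ℝ) 1)
    (f := fun r => ψ (S.act x (γ r)) - c) (by simp) h
  simpa using this

lemma abs_avg_le (hγ : Measurable γ) (hψ : Measurable ψ) (hB : ∀ x, |ψ x| ≤ B) (x : X) :
    |S.avg γ ψ x| ≤ B := by
  simpa using abs_avg_sub_le (S := S) (c := 0) hγ hψ hB (x := x) fun r _ => by simpa using hB _

lemma avg_nonneg (hψ : ∀ x, 0 ≤ ψ x) (x : X) : 0 ≤ S.avg γ ψ x :=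
  integral_nonneg fun _ => hψ _

lemma abs_avg_act_sub_avg_le (hγ : Measurable γ) (hψ : Measurable ψ) (hB : ∀ x, |ψ x| ≤ B)
    {x : X} {g : Heis} {δ : ℝ}
    (h : ∀ r ∈ Ioc (0 : ℝ) 1, |ψ (S.act (S.act x g) (γ r)) - ψ (S.act x (γ r))| ≤ δ) :
    |S.avg γ ψ (S.act x g) - S.avg γ ψ x| ≤ δ := by
  unfold avg
  rw [← integral_sub (integrable_act_curve hγ hψ hB _) (integrable_act_curve hγ hψ hB x)]
  have := norm_setIntegral_le_of_norm_le_const (μ := volume) (s := Ioc (0 : ℝ) 1)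
    (f := fun r => ψ (S.act (S.act x g) (γ r)) - ψ (S.act x (γ r))) (by simp) h
  simpa using this

lemma IsTest.avg (hφ : S.IsTest φ) (hγ : Measurable γ) {c : ℝ}
    (hc : ∀ r ∈ Ioc (0 : ℝ) 1, |(γ r).1| + |(γ r).2.1| ≤ c) : S.IsTest (S.avg γ φ) := by
  obtain ⟨B, hB0, hB⟩ := hφ.bdd
  obtain ⟨K, hK0, hK⟩ := hφ.lip
  have hc0 : 0 ≤ c := le_trans (by positivity) (hc 1 (by simp))
  refine ⟨measurable_avg hγ hφ.measurable, ⟨B, hB0, abs_avg_le hγ hφ.measurable hB⟩,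
    ⟨K * (1 + c), by positivity, fun x g => abs_avg_act_sub_avg_le hγ hφ.measurable hB
      fun r hr => ?_⟩⟩
  have e : S.act (S.act x g) (γ r)
      = S.act (S.act x (γ r)) (g.1, g.2.1, g.2.2 + g.1 * (γ r).2.1 - (γ r).1 * g.2.1) := by
    rw [S.act_act, S.act_act]
    congr 1
    ext <;> simp [hMul] <;> ring
  rw [e]
  refine (hK _ _).trans ?_
  rw [mul_assoc]
  gcongr
  have h1 : |g.2.2 + g.1 * (γ r).2.1 - (γ r).1 * g.2.1| ≤ |g.2.2| + |g.1| * |(γ r).2.1|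
      + |(γ r).1| * |g.2.1| := by
    rw [← abs_mul, ← abs_mul]
    exact (abs_sub _ _).trans (add_le_add (abs_add_le _ _) le_rfl)
  have h2 := hc r hr
  have h3 := abs_nonneg (γ r).1
  have h4 := abs_nonneg (γ r).2.1
  have h5 : |g.1| * |(γ r).2.1| ≤ |g.1| * c := by gcongr; linarith
  have h6 : |(γ r).1| * |g.2.1| ≤ c * |g.2.1| := by gcongr; linarith
  simp only [hSize]
  nlinarith [abs_nonneg g.2.2]

lemma integrable_act_curve_mul [SFinite μ] (hγ : Measurable γ) (hψ : Measurable ψ)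
    (hB : ∀ x, |ψ x| ≤ B) (hw : Integrable w μ) :
    Integrable (fun q : X × ℝ => ψ (S.act q.1 (γ q.2)) * w q.1)
      (μ.prod (volume.restrict (Ioc (0 : ℝ) 1))) :=
  (hw.comp_fst (volume.restrict (Ioc (0 : ℝ) 1))).bdd_mul
    (measurable_act_curve (S := S) hγ hψ).aestronglyMeasurable (ae_of_all _ fun _ => hB _)

lemma integral_avg_mul [SFinite μ] (hγ : Measurable γ) (hψ : Measurable ψ)
    (hB : ∀ x, |ψ x| ≤ B) (hw : Integrable w μ) :
    ∫ x, S.avg γ ψ x * w x ∂μ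
      = ∫ r in Ioc (0 : ℝ) 1, ∫ x, ψ (S.act x (γ r)) * w x ∂μ := by
  rw [← integral_integral_swap (integrable_act_curve_mul hγ hψ hB hw)]
  simp only [avg, integral_mul_const]

lemma abs_integral_act_mul_sub_le (hψ : Measurable ψ) (hB : ∀ x, |ψ x| ≤ B)
    (hw : Integrable w μ) (g : Heis) :
    |∫ x, ψ (S.act x g) * w x ∂μ - ∫ x, ψ x * w x ∂μ| ≤ B * S.osc w g := by
  have hψg : Measurable fun x => ψ (S.act x g) := hψ.comp (S.measurable_act_right g)
  rw [← S.integral_act g (fun x => ψ x * w x), ← integral_sub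
    (integrable_mul_of_bdd hψg (fun _ => hB _) hw)
    (S.integrable_act g (integrable_mul_of_bdd hψ hB hw))]
  refine le_trans (le_of_eq ?_) (abs_integral_mul_le hψg (fun _ => hB _)
    (integrable_incr (S := S) hw g))
  rw [← abs_neg, ← integral_neg]
  congr 2 with x
  simp only [incr]
  ring

lemma abs_integral_avg_mul_sub_le [SFinite μ] (hγ : Measurable γ) (hψ : Measurable ψ)
    (hB0 : 0 ≤ B) (hB : ∀ x, |ψ x| ≤ B) (hw : Integrable w μ) {ε : ℝ}
    (h : ∀ r ∈ Ioc (0 : ℝ) 1, S.osc w (γ r) ≤ ε) :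
    |∫ x, S.avg γ ψ x * w x ∂μ - ∫ x, ψ x * w x ∂μ| ≤ B * ε := by
  rw [integral_avg_mul hγ hψ hB hw]
  have e : (∫ r in Ioc (0 : ℝ) 1, ∫ x, ψ (S.act x (γ r)) * w x ∂μ) - ∫ x, ψ x * w x ∂μ
      = ∫ r in Ioc (0 : ℝ) 1, ((∫ x, ψ (S.act x (γ r)) * w x ∂μ) - ∫ x, ψ x * w x ∂μ) := by
    rw [integral_sub (integrable_act_curve_mul hγ hψ hB hw).integral_prod_right
      (integrable_const _)]
    simp
  rw [e]
  have := norm_setIntegral_le_of_norm_le_const (μ := volume) (s := Ioc (0 : ℝ) 1)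
    (f := fun r => (∫ x, ψ (S.act x (γ r)) * w x ∂μ) - ∫ x, ψ x * w x ∂μ) (C := B * ε)
    (by simp) fun r hr => (abs_integral_act_mul_sub_le hψ hB hw (γ r)).trans
      (mul_le_mul_of_nonneg_left (h r hr) hB0)
  simpa using this

lemma abs_integral_shift_sub_le {G : ℝ → ℝ} (hG : Measurable G) (hB : ∀ r, |G r| ≤ B)
    {ρ : ℝ} (hρ : 0 < ρ) (h : ℝ) :
    |(∫ r in Ioc (0 : ℝ) 1, G (ρ * r + h)) - ∫ r in Ioc (0 : ℝ) 1, G (ρ * r)|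
      ≤ 2 * B / ρ * |h| := by
  have hi : ∀ a b, IntervalIntegrable G volume a b := fun a b => by
    rw [intervalIntegrable_iff]
    exact Measure.integrableOn_of_bounded (M := B) (by simp [uIoc]) hG.aestronglyMeasurable
      (ae_of_all _ fun r => hB _)
  have e2 := intervalIntegral.integral_comp_mul_add G hρ.ne' h (a := 0) (b := 1)
  have e3 := intervalIntegral.integral_comp_mul_left G hρ.ne' (a := 0) (b := 1)
  rw [← intervalIntegral.integral_of_le zero_le_one, ← intervalIntegral.integral_of_le
    zero_le_one, e2, e3]
  simp only [mul_zero, mul_one, zero_add, smul_eq_mul]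
  rw [← mul_sub, intervalIntegral.integral_interval_sub_interval_comm (hi _ _) (hi _ _) (hi _ _)]
  have h1 := intervalIntegral.norm_integral_le_of_norm_le_const (f := G) (a := h) (b := 0)
    (C := B) fun x _ => hB x
  have h2 := intervalIntegral.norm_integral_le_of_norm_le_const (f := G) (a := ρ + h) (b := ρ)
    (C := B) fun x _ => hB x
  simp only [Real.norm_eq_abs, zero_sub, abs_neg, sub_add_cancel_left] at h1 h2
  rw [abs_mul, abs_of_pos (inv_pos.2 hρ)]
  calc _ ≤ ρ⁻¹ * (B * |h| + B * |h|) := by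
        gcongr
        exact (abs_sub _ _).trans (add_le_add h1 h2)
    _ = _ := by field_simp; ring

lemma abs_avg_subgroup_sub_le {Γ : ℝ → Heis} (hΓ : Measurable Γ)
    (hadd : ∀ a b, hMul (Γ a) (Γ b) = Γ (b + a)) (hψ : Measurable ψ) (hB : ∀ x, |ψ x| ≤ B)
    {ρ : ℝ} (hρ : 0 < ρ) (x : X) (h : ℝ) :
    |S.avg (fun r => Γ (ρ * r)) ψ (S.act x (Γ h)) - S.avg (fun r => Γ (ρ * r)) ψ x|
      ≤ 2 * B / ρ * |h| := by
  have := abs_integral_shift_sub_le (G := fun r => ψ (S.act x (Γ r)))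
    ((measurable_act_curve (S := S) hΓ hψ).comp (measurable_const.prodMk measurable_id))
    (fun r => hB _) hρ h
  simpa only [avg, S.act_act, hadd] using this

/-- The subgroup generated by `X`. -/
def hX (a : ℝ) : Heis := (a, 0, 0)

/-- The subgroup generated by `Y`. -/
def hY (b : ℝ) : Heis := (0, b, 0)

lemma measurable_hX : Measurable hX := by unfold hX; fun_prop
lemma measurable_hY : Measurable hY := by unfold hY; fun_prop
lemma measurable_hCen : Measurable hCen := by unfold hCen; fun_prop

variable (S) in
/-- The average over a small box in the Heisenberg group. -/
def boxAvg (ρ : ℝ) (ψ : X → ℝ) : X → ℝ :=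
  S.avg (fun r => hY (ρ * r)) (S.avg (fun r => hX (ρ * r)) (S.avg (fun r => hCen (ρ * r)) ψ))

lemma isTest_boxAvg (hψ : Measurable ψ) (hB0 : 0 ≤ B) (hB : ∀ x, |ψ x| ≤ B) {ρ : ℝ}
    (hρ : 0 < ρ) (hρ1 : ρ ≤ 1) : S.IsTest (S.boxAvg ρ ψ) := by
  have mX : Measurable fun r : ℝ => hX (ρ * r) := measurable_hX.comp (measurable_const_mul ρ)
  have mY : Measurable fun r : ℝ => hY (ρ * r) := measurable_hY.comp (measurable_const_mul ρ)
  have mZ : Measurable fun r : ℝ => hCen (ρ * r) :=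
    measurable_hCen.comp (measurable_const_mul ρ)
  set G := S.avg (fun r => hCen (ρ * r)) ψ with hG
  set F := S.avg (fun r => hX (ρ * r)) G with hF
  set E := S.avg (fun r => hY (ρ * r)) F with hE
  have mG : Measurable G := measurable_avg mZ hψ
  have bG : ∀ x, |G x| ≤ B := abs_avg_le mZ hψ hB
  have mF : Measurable F := measurable_avg mX mG
  have bF : ∀ x, |F x| ≤ B := abs_avg_le mX mG bG
  have mE : Measurable E := measurable_avg mY mF
  have bE : ∀ x, |E x| ≤ B := abs_avg_le mY mF bF
  set K := 2 * B / ρ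
  have hK : 0 ≤ K := by positivity
  have GZ : ∀ x h, |G (S.act x (hCen h)) - G x| ≤ K * |h| := fun x h =>
    abs_avg_subgroup_sub_le measurable_hCen
      (fun a b => by ext <;> simp [hCen, hMul]; ring) hψ hB hρ x h
  have FX : ∀ x h, |F (S.act x (hX h)) - F x| ≤ K * |h| := fun x h =>
    abs_avg_subgroup_sub_le measurable_hX
      (fun a b => by ext <;> simp [hX, hMul]; ring) mG bG hρ x h
  have EY : ∀ x h, |E (S.act x (hY h)) - E x| ≤ K * |h| := fun x h =>
    abs_avg_subgroup_sub_le measurable_hY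
      (fun a b => by ext <;> simp [hY, hMul]; ring) mF bF hρ x h
  have hcomm : ∀ x h g, S.act (S.act x (hCen h)) g = S.act (S.act x g) (hCen h) := by
    intro x h g
    rw [S.act_act, S.act_act]
    congr 1
    ext <;> simp [hMul, hCen]; ring
  have FZ : ∀ x h, |F (S.act x (hCen h)) - F x| ≤ K * |h| := fun x h =>
    abs_avg_act_sub_avg_le mX mG bG fun r _ => by rw [hcomm]; exact GZ _ _
  have EZ : ∀ x h, |E (S.act x (hCen h)) - E x| ≤ K * |h| := fun x h =>
    abs_avg_act_sub_avg_le mY mF bF fun r _ => by rw [hcomm]; exact FZ _ _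
  have EX : ∀ x h, |E (S.act x (hX h)) - E x| ≤ 2 * K * |h| := fun x h =>
    abs_avg_act_sub_avg_le mY mF bF fun r hr => by
      have e : S.act (S.act x (hX h)) (hY (ρ * r))
          = S.act (S.act (S.act x (hY (ρ * r))) (hX h)) (hCen (h * (ρ * r))) := by
        simp only [S.act_act]
        congr 1
        ext <;> simp [hMul, hCen, hX, hY]
      rw [e]
      have h1 := FZ (S.act (S.act x (hY (ρ * r))) (hX h)) (h * (ρ * r))
      have h2 := FX (S.act x (hY (ρ * r))) h
      have h3 : |h * (ρ * r)| ≤ |h| := by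
        rw [abs_mul]
        refine mul_le_of_le_one_right (abs_nonneg _) ?_
        rw [abs_of_nonneg (mul_nonneg hρ.le hr.1.le)]
        exact mul_le_one₀ hρ1 hr.1.le hr.2
      have h4 := abs_sub_le (F (S.act (S.act (S.act x (hY (ρ * r))) (hX h)) (hCen (h * (ρ * r)))))
        (F (S.act (S.act x (hY (ρ * r))) (hX h))) (F (S.act x (hY (ρ * r))))
      have h5 : K * |h * (ρ * r)| ≤ K * |h| := by gcongr
      linarith
  refine ⟨mE, ⟨B, hB0, bE⟩, ⟨2 * K, by positivity, fun x g => ?_⟩⟩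
  have e : S.act x g = S.act (S.act (S.act x (hY g.2.1)) (hX g.1)) (hCen g.2.2) := by
    simp only [S.act_act]
    congr 1
    ext <;> simp [hMul, hCen, hX, hY]
  change |E (S.act x g) - E x| ≤ _
  rw [e]
  have h1 := EZ (S.act (S.act x (hY g.2.1)) (hX g.1)) g.2.2
  have h2 := EX (S.act x (hY g.2.1)) g.1
  have h3 := EY x g.2.1
  have h4 := abs_sub_le (E (S.act (S.act (S.act x (hY g.2.1)) (hX g.1)) (hCen g.2.2)))
    (E (S.act (S.act x (hY g.2.1)) (hX g.1))) (E x)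
  have h5 := abs_sub_le (E (S.act (S.act x (hY g.2.1)) (hX g.1))) (E (S.act x (hY g.2.1))) (E x)
  simp only [hSize]
  nlinarith [mul_nonneg hK (abs_nonneg g.2.1), mul_nonneg hK (abs_nonneg g.2.2)]

lemma exists_isTest_approx [SFinite μ] (hψ : Measurable ψ) (h0 : ∀ x, 0 ≤ ψ x)
    (h1 : ∀ x, ψ x ≤ 1) (hw : Integrable w μ) (hc : S.TransCont w) {ε : ℝ} (hε : 0 < ε) :
    ∃ φ, S.IsTest φ ∧ (∀ x, 0 ≤ φ x) ∧ (∀ x, φ x ≤ 1) ∧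
      |∫ x, φ x * w x ∂μ - ∫ x, ψ x * w x ∂μ| ≤ ε := by
  obtain ⟨ρ', hρ', h⟩ := hc (ε / 3) (by positivity)
  set ρ := min ρ' 1
  have hρ : 0 < ρ := by positivity
  have hρr : ∀ r ∈ Ioc (0 : ℝ) 1, |ρ * r| ≤ ρ' := fun r hr => by
    rw [abs_of_nonneg (mul_nonneg hρ.le hr.1.le)]
    exact (mul_le_of_le_one_right hρ.le hr.2).trans (min_le_left _ _)
  have hB : ∀ x, |ψ x| ≤ 1 := fun x => abs_le.2 ⟨by linarith [h0 x], h1 x⟩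
  have mX : Measurable fun r : ℝ => hX (ρ * r) := measurable_hX.comp (measurable_const_mul ρ)
  have mY : Measurable fun r : ℝ => hY (ρ * r) := measurable_hY.comp (measurable_const_mul ρ)
  have mZ : Measurable fun r : ℝ => hCen (ρ * r) :=
    measurable_hCen.comp (measurable_const_mul ρ)
  have mG := measurable_avg (S := S) mZ hψ
  have bG := abs_avg_le (S := S) mZ hψ hB
  have mF := measurable_avg (S := S) mX mG
  have bF := abs_avg_le (S := S) mX mG bG
  refine ⟨S.boxAvg ρ ψ, isTest_boxAvg hψ zero_le_one hB hρ (min_le_right _ _),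
    avg_nonneg (avg_nonneg (avg_nonneg h0)),
    fun x => (le_abs_self _).trans (abs_avg_le mY mF bF x), ?_⟩
  have e1 := abs_integral_avg_mul_sub_le mZ hψ zero_le_one hB hw fun r hr =>
    h (hCen (ρ * r)) (by simpa [hSize, hCen] using hρr r hr)
  have e2 := abs_integral_avg_mul_sub_le mX mG zero_le_one bG hw fun r hr =>
    h (hX (ρ * r)) (by simpa [hSize, hX] using hρr r hr)
  have e3 := abs_integral_avg_mul_sub_le mY mF zero_le_one bF hw fun r hr =>
    h (hY (ρ * r)) (by simpa [hSize, hY] using hρr r hr)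
  rw [abs_le] at e1 e2 e3 ⊢
  unfold boxAvg
  constructor <;> linarith [e1.1, e1.2, e2.1, e2.2, e3.1, e3.2]

end HeisAction

/-- The limit of a bounded real sequence along a fixed ultrafilter. -/
def ulim (a : ℕ → ℝ) : ℝ := limUnder (hyperfilter ℕ : Filter ℕ) a

lemma tendsto_ulim {a : ℕ → ℝ} {C : ℝ} (h : ∀ n, |a n| ≤ C) :
    Tendsto a (hyperfilter ℕ) (𝓝 (ulim a)) := by
  obtain ⟨x, -, hx⟩ := (isCompact_Icc (a := -C) (b := C)).ultrafilter_le_nhds'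
    ((hyperfilter ℕ).map a) (by
      simp only [Ultrafilter.mem_map]
      exact Filter.univ_mem' fun n => abs_le.1 (h n))
  exact tendsto_nhds_limUnder ⟨x, hx⟩

lemma tendsto_error {C : ℝ} :
    Tendsto (fun n : ℕ => C * (1 / ((n : ℝ) + 1))) (hyperfilter ℕ) (𝓝 0) := by
  have := (tendsto_one_div_add_atTop_nhds_zero_nat (𝕜 := ℝ)).const_mul C
  rw [mul_zero] at this
  exact this.mono_left Nat.hyperfilter_le_atTop

lemma hMul_hCen_comm (t : ℝ) (g : Heis) : hMul (hCen t) g = hMul g (hCen t) := by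
  ext <;> simp [hMul, hCen]; ring

lemma hSize_hCen (t : ℝ) : hSize (hCen t) = |t| := by simp [hSize, hCen]

namespace HeisAction

variable {X : Type*} [MeasurableSpace X] {μ : Measure X} {S : HeisAction μ}
variable {φ ψ w u : X → ℝ} {B K M : ℝ}

lemma abs_integral_mul_act_sub_le (hφ : S.IsTest φ)
    (hK : ∀ x g, |φ (S.act x g) - φ x| ≤ K * hSize g) (hw : Integrable w μ) (g : Heis) :
    |∫ x, φ x * w (S.act x g) ∂μ - ∫ x, φ x * w x ∂μ|
      ≤ K * hSize (hInv g) * ∫ x, |w x| ∂μ := by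
  obtain ⟨B, hB0, hB⟩ := hφ.bdd
  have hm : Measurable fun x => φ (S.act x (hInv g)) :=
    hφ.measurable.comp (S.measurable_act_right _)
  rw [← integral_act_mul, ← integral_sub (integrable_mul_of_bdd hm (fun _ => hB _) hw)
    (hφ.integrable_mul hw)]
  simp only [← sub_mul]
  exact abs_integral_mul_le (hm.sub hφ.measurable) (fun x => hK x _) hw

variable (S) in
/-- Difference quotients of `u` in the direction `v`, tested against `φ`. -/
def diffQ (u : X → ℝ) (v : ℝ × ℝ) (φ : X → ℝ) (n : ℕ) : ℝ :=
  ((n : ℝ) + 1) * ∫ x, φ x * S.incr u (hExp ((1 / ((n : ℝ) + 1)) • v)) x ∂μ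

variable (S) in
/-- The weak derivative of `u` in the direction `v`, as a functional on test functions. -/
def ell (u : X → ℝ) (v : ℝ × ℝ) (φ : X → ℝ) : ℝ := ulim (S.diffQ u v φ)

lemma HorizLip.osc_smul_le (hu : S.HorizLip u M) {h : ℝ} (hh : 0 ≤ h) (v : ℝ × ℝ) :
    S.osc u (hExp (h • v)) ≤ h * (M * vSize v) := by
  have := hu.osc_le (h • v)
  rw [vSize_smul, abs_of_nonneg hh] at this
  linarith

lemma HorizLip.abs_diffQ_le (hu : S.HorizLip u M) (hφ : Measurable φ) (hB0 : 0 ≤ B)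
    (hB : ∀ x, |φ x| ≤ B) (v : ℝ × ℝ) (n : ℕ) : |S.diffQ u v φ n| ≤ B * (M * vSize v) := by
  have hn : (0 : ℝ) < n + 1 := by positivity
  have h1 := abs_integral_mul_le hφ hB
    (integrable_incr (S := S) hu.integrable (hExp ((1 / ((n : ℝ) + 1)) • v)))
  have h2 := hu.osc_smul_le (h := 1 / ((n : ℝ) + 1)) (by positivity) v
  rw [diffQ, abs_mul, abs_of_pos hn]
  calc _ ≤ ((n : ℝ) + 1) * (B * (1 / ((n : ℝ) + 1) * (M * vSize v))) := by
        gcongr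
        exact h1.trans (mul_le_mul_of_nonneg_left h2 hB0)
    _ = _ := by field_simp

lemma HorizLip.tendsto_diffQ (hu : S.HorizLip u M) (hφ : S.IsTest φ) (v : ℝ × ℝ) :
    Tendsto (S.diffQ u v φ) (hyperfilter ℕ) (𝓝 (S.ell u v φ)) := by
  obtain ⟨B, hB0, hB⟩ := hφ.bdd
  exact tendsto_ulim (hu.abs_diffQ_le hφ.measurable hB0 hB v)

lemma HorizLip.abs_ell_le (hu : S.HorizLip u M) (hφ : S.IsTest φ) (hB0 : 0 ≤ B)
    (hB : ∀ x, |φ x| ≤ B) (v : ℝ × ℝ) : |S.ell u v φ| ≤ B * (M * vSize v) :=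
  le_of_tendsto (hu.tendsto_diffQ hφ v).abs
    (Eventually.of_forall (hu.abs_diffQ_le hφ.measurable hB0 hB v))

lemma HorizLip.ell_eq_of_abs_sub_le (hu : S.HorizLip u M) (hφ : S.IsTest φ) {v : ℝ × ℝ}
    {a C : ℝ} (h : ∀ n : ℕ, |S.diffQ u v φ n - a| ≤ C * (1 / ((n : ℝ) + 1))) :
    S.ell u v φ = a := by
  refine tendsto_nhds_unique (hu.tendsto_diffQ hφ v) ?_
  rw [tendsto_iff_norm_sub_tendsto_zero]
  exact squeeze_zero (fun _ => norm_nonneg _) h tendsto_error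

lemma HorizLip.ell_add (hu : S.HorizLip u M) (hφ : S.IsTest φ) (hψ : S.IsTest ψ)
    (v : ℝ × ℝ) : S.ell u v (fun x => φ x + ψ x) = S.ell u v φ + S.ell u v ψ := by
  refine tendsto_nhds_unique (hu.tendsto_diffQ (hφ.add hψ) v) ?_
  refine ((hu.tendsto_diffQ hφ v).add (hu.tendsto_diffQ hψ v)).congr fun n => ?_
  have hi := integrable_incr (S := S) hu.integrable (hExp ((1 / ((n : ℝ) + 1)) • v))
  simp only [diffQ, add_mul]
  rw [integral_add (hφ.integrable_mul hi) (hψ.integrable_mul hi)]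
  ring

lemma HorizLip.ell_const_mul (hu : S.HorizLip u M) (hφ : S.IsTest φ) (c : ℝ)
    (v : ℝ × ℝ) : S.ell u v (fun x => c * φ x) = c * S.ell u v φ := by
  refine tendsto_nhds_unique (hu.tendsto_diffQ (hφ.const_mul c) v) ?_
  refine ((hu.tendsto_diffQ hφ v).const_mul c).congr fun n => ?_
  simp only [diffQ, mul_assoc]
  rw [integral_const_mul]
  ring

lemma HorizLip.ell_sub (hu : S.HorizLip u M) (hφ : S.IsTest φ) (hψ : S.IsTest ψ)
    (v : ℝ × ℝ) : S.ell u v (fun x => φ x - ψ x) = S.ell u v φ - S.ell u v ψ := by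
  have h := hu.ell_add hφ (hψ.const_mul (-1)) v
  rw [hu.ell_const_mul hψ] at h
  simpa [sub_eq_add_neg] using h

lemma HorizLip.ell_sum (hu : S.HorizLip u M) {ι : Type*} (s : Finset ι) {φ : ι → X → ℝ}
    (hφ : ∀ i ∈ s, S.IsTest (φ i)) (v : ℝ × ℝ) :
    S.ell u v (fun x => ∑ i ∈ s, φ i x) = ∑ i ∈ s, S.ell u v (φ i) := by
  classical
  induction s using Finset.induction_on with
  | empty =>
    have := hu.ell_const_mul (IsTest.const (S := S) 0) 0 v
    simpa using this
  | insert i s hi ih =>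
    simp only [Finset.sum_insert hi]
    have hs : ∀ j ∈ s, S.IsTest (φ j) := fun j hj => hφ j (Finset.mem_insert_of_mem hj)
    rw [hu.ell_add (hφ i (Finset.mem_insert_self _ _)) (IsTest.sum s hs), ih hs]

lemma HorizLip.abs_integral_incr_hMul_sub_le (hu : S.HorizLip u M) (hφ : S.IsTest φ)
    (hK : ∀ x g, |φ (S.act x g) - φ x| ≤ K * hSize g) (g h : Heis) :
    |∫ x, φ x * S.incr u (hMul g h) x ∂μ - ∫ x, φ x * S.incr u g x ∂μ
      - ∫ x, φ x * S.incr u h x ∂μ| ≤ K * hSize (hInv g) * S.osc u h := by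
  have hi := integrable_incr (S := S) hu.integrable
  have e := abs_integral_mul_act_sub_le hφ hK (hi h) g
  simp only [incr_hMul, mul_add]
  rw [integral_add (hφ.integrable_mul (hi g)) (hφ.integrable_mul (S.integrable_act g (hi h))),
    add_sub_cancel_left]
  exact e

lemma HorizLip.abs_integral_incr_le (hu : S.HorizLip u M) (hφ : S.IsTest φ)
    (hK : ∀ x g, |φ (S.act x g) - φ x| ≤ K * hSize g) (g : Heis) :
    |∫ x, φ x * S.incr u g x ∂μ| ≤ K * hSize (hInv g) * ∫ x, |u x| ∂μ := by
  have e := abs_integral_mul_act_sub_le hφ hK hu.integrable g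
  simp only [incr, mul_sub]
  rwa [integral_sub (hφ.integrable_mul (S.integrable_act g hu.integrable))
    (hφ.integrable_mul hu.integrable)]

lemma HorizLip.ell_add_left (hu : S.HorizLip u M) (hφ : S.IsTest φ) (v w : ℝ × ℝ) :
    S.ell u (v + w) φ = S.ell u v φ + S.ell u w φ := by
  obtain ⟨K, hK0, hK⟩ := hφ.lip
  set I := ∫ x, |u x| ∂μ
  have hI : 0 ≤ I := integral_nonneg fun _ => abs_nonneg _
  have hM := hu.nonneg
  set c := (v.1 * w.2 - v.2 * w.1) / 2
  set A := K * (vSize v + vSize v ^ 2) * (M * vSize w) + K * |c| * I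
    + K * |c| * (M * vSize (v + w)) with hA
  have key : ∀ n : ℕ, |S.diffQ u (v + w) φ n - (S.diffQ u v φ n + S.diffQ u w φ n)|
      ≤ A * (1 / ((n : ℝ) + 1)) := by
    intro n
    have hn : (0 : ℝ) < n + 1 := by positivity
    set h : ℝ := 1 / ((n : ℝ) + 1) with hh
    have h0 : 0 ≤ h := by positivity
    have h1 : h ≤ 1 := by
      rw [hh, div_le_one hn]; linarith [(Nat.cast_nonneg n : (0 : ℝ) ≤ n)]
    have e1 := hu.abs_integral_incr_hMul_sub_le hφ hK (hExp (h • v)) (hExp (h • w))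
    have e2 := hu.abs_integral_incr_hMul_sub_le hφ hK (hCen (h ^ 2 * c)) (hExp (h • (v + w)))
    have e3 := hu.abs_integral_incr_le hφ hK (hCen (h ^ 2 * c))
    have e4 : hMul (hExp (h • v)) (hExp (h • w))
        = hMul (hCen (h ^ 2 * c)) (hExp (h • (v + w))) := by
      rw [hMul_hExp_hExp, hMul_hCen_comm, ← smul_add]
      congr 2
      simp [c]; ring
    rw [e4] at e1
    rw [hInv_hCen, hSize_hCen, abs_neg, abs_mul, abs_of_nonneg (sq_nonneg h)] at e2 e3
    have hs : hSize (hInv (hExp (h • v))) ≤ h * (vSize v + vSize v ^ 2) := by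
      rw [hInv_hExp, ← neg_smul]
      have := hSize_hExp_smul_le (h := -h) (by rwa [abs_neg, abs_of_nonneg h0]) v
      rwa [abs_neg, abs_of_nonneg h0] at this
    have o1 := hu.osc_smul_le h0 w
    have o2 := hu.osc_smul_le h0 (v + w)
    have nv := vSize_nonneg v
    have nw := vSize_nonneg w
    have nvw := vSize_nonneg (v + w)
    have b1 : K * hSize (hInv (hExp (h • v))) * S.osc u (hExp (h • w))
        ≤ K * (h * (vSize v + vSize v ^ 2)) * (h * (M * vSize w)) := by
      gcongr
      exact osc_nonneg _
    have b2 : K * (h ^ 2 * |c|) * S.osc u (hExp (h • (v + w)))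
        ≤ K * (h ^ 2 * |c|) * (1 * (M * vSize (v + w))) := by
      gcongr
      exact o2.trans (by gcongr)
    have total : |(∫ x, φ x * S.incr u (hExp (h • (v + w))) x ∂μ)
        - ((∫ x, φ x * S.incr u (hExp (h • v)) x ∂μ)
          + ∫ x, φ x * S.incr u (hExp (h • w)) x ∂μ)| ≤ A * (h * h) := by
      rw [abs_le] at e1 e2 e3 ⊢
      have : A * (h * h) = K * (h * (vSize v + vSize v ^ 2)) * (h * (M * vSize w))
          + K * (h ^ 2 * |c|) * I + K * (h ^ 2 * |c|) * (1 * (M * vSize (v + w))) := by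
        rw [hA]; ring
      rw [this]
      constructor <;> linarith [e1.1, e1.2, e2.1, e2.2, e3.1, e3.2]
    unfold diffQ
    rw [← mul_add, ← mul_sub, abs_mul, abs_of_pos hn, ← hh]
    calc _ ≤ ((n : ℝ) + 1) * (A * (h * h)) := by gcongr
      _ = A * h := by rw [hh]; field_simp
  refine tendsto_nhds_unique (hu.tendsto_diffQ hφ (v + w)) ?_
  have h1 := (hu.tendsto_diffQ hφ v).add (hu.tendsto_diffQ hφ w)
  have h2 := squeeze_zero_norm
    (f := fun n => S.diffQ u (v + w) φ n - (S.diffQ u v φ n + S.diffQ u w φ n)) key tendsto_error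
  have h3 := h2.add h1
  rw [zero_add] at h3
  exact h3.congr fun n => by ring

lemma HorizLip.ell_eq (hu : S.HorizLip u M) (hφ : S.IsTest φ) (v : ℝ × ℝ) :
    S.ell u v φ = v.1 * S.ell u (1, 0) φ + v.2 * S.ell u (0, 1) φ := by
  obtain ⟨B, hB0, hB⟩ := hφ.bdd
  let F : ℝ × ℝ →+ ℝ := AddMonoidHom.mk' (fun v => S.ell u v φ) (hu.ell_add_left hφ)
  have hF : Continuous F := by
    refine AddMonoidHomClass.continuous_of_bound F (B * (M * 2)) fun v => ?_
    refine (hu.abs_ell_le hφ hB0 hB v).trans ?_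
    have h1 : vSize v ≤ 2 * ‖v‖ := by
      have := norm_fst_le v
      have := norm_snd_le v
      simp only [Real.norm_eq_abs] at *
      unfold vSize; linarith
    have := hu.nonneg
    calc B * (M * vSize v) ≤ B * (M * (2 * ‖v‖)) := by gcongr
      _ = _ := by ring
  have e : v = v.1 • ((1, 0) : ℝ × ℝ) + v.2 • ((0, 1) : ℝ × ℝ) := by ext <;> simp
  have h := congrArg (F.toRealLinearMap hF) e
  rw [map_add, map_smul, map_smul] at h
  exact h

end HeisAction

lemma abs_integral_shift_sub_sub_le {F : ℝ → ℝ} {L : ℝ} (hL : ∀ a b, |F a - F b| ≤ L * |a - b|)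
    {s h : ℝ} (hs : 0 < s) (hh : 0 ≤ h) :
    |(∫ r in Ioc (0 : ℝ) 1, (F (s * r + h) - F (s * r))) - h / s * (F s - F 0)|
      ≤ 2 * L / s * h ^ 2 := by
  have hc : Continuous F := by
    refine (LipschitzWith.of_dist_le_mul (K := L.toNNReal) fun a b => ?_).continuous
    rw [Real.dist_eq, Real.dist_eq]
    exact (hL a b).trans (mul_le_mul_of_nonneg_right (Real.le_coe_toNNReal L) (abs_nonneg _))
  have hL0 : 0 ≤ L := by simpa using (abs_nonneg _).trans (hL 1 0)
  have hi : ∀ a b, IntervalIntegrable F volume a b := fun a b => hc.intervalIntegrable a b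
  have local_le : ∀ a, |(∫ x in a..(a + h), F x) - h * F a| ≤ L * h ^ 2 := by
    intro a
    have e : (∫ x in a..(a + h), F x) - h * F a = ∫ x in a..(a + h), (F x - F a) := by
      rw [intervalIntegral.integral_sub (hi _ _) (by simp)]
      simp
    rw [e]
    have := intervalIntegral.norm_integral_le_of_norm_le_const (f := fun x => F x - F a)
      (a := a) (b := a + h) (C := L * h) fun x hx => by
        rw [uIoc_of_le (by linarith)] at hx
        refine (hL x a).trans ?_
        gcongr
        rw [abs_of_nonneg (by linarith [hx.1])]
        linarith [hx.2]
    rw [add_sub_cancel_left, abs_of_nonneg hh] at this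
    calc _ ≤ _ := this
      _ = _ := by ring
  have h1 := local_le s
  have h2 := local_le 0
  have e2 := intervalIntegral.integral_comp_mul_add F hs.ne' h (a := 0) (b := 1)
  have e3 := intervalIntegral.integral_comp_mul_left F hs.ne' (a := 0) (b := 1)
  have e : (∫ r in Ioc (0 : ℝ) 1, (F (s * r + h) - F (s * r)))
      = s⁻¹ * ((∫ x in s..(s + h), F x) - ∫ x in (0 : ℝ)..(0 + h), F x) := by
    rw [← intervalIntegral.integral_of_le zero_le_one, intervalIntegral.integral_sub
      ((by fun_prop : Continuous fun r => F (s * r + h)).intervalIntegrable _ _)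
      ((by fun_prop : Continuous fun r => F (s * r)).intervalIntegrable _ _), e2, e3]
    simp only [mul_zero, mul_one, zero_add, smul_eq_mul]
    rw [← mul_sub, intervalIntegral.integral_interval_sub_interval_comm' (hi _ _) (hi _ _)
      (hi _ _)]
  rw [e]
  have e4 : s⁻¹ * ((∫ x in s..(s + h), F x) - ∫ x in (0 : ℝ)..(0 + h), F x) - h / s * (F s - F 0)
      = s⁻¹ * (((∫ x in s..(s + h), F x) - h * F s) - ((∫ x in (0 : ℝ)..(0 + h), F x) - h * F 0)) := by
    ring
  rw [e4, abs_mul, abs_of_pos (inv_pos.2 hs)]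
  calc _ ≤ s⁻¹ * (L * h ^ 2 + L * h ^ 2) := by
        gcongr
        exact (abs_sub _ _).trans (add_le_add h1 h2)
    _ = _ := by field_simp; ring

namespace HeisAction

variable {X : Type*} [MeasurableSpace X] {μ : Measure X} {S : HeisAction μ}
variable {φ ψ w u : X → ℝ} {B K M : ℝ}

variable (S) in
/-- The average of `φ` over the segment of length `s` in the direction `-v`. -/
def segAvg (s : ℝ) (v : ℝ × ℝ) (φ : X → ℝ) : X → ℝ := S.avg (fun r => hExp ((-(s * r)) • v)) φ

lemma measurable_segCurve (s : ℝ) (v : ℝ × ℝ) :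
    Measurable fun r : ℝ => hExp ((-(s * r)) • v) := by
  unfold hExp; fun_prop

lemma IsTest.segAvg (hφ : S.IsTest φ) (s : ℝ) (v : ℝ × ℝ) : S.IsTest (S.segAvg s v φ) := by
  refine hφ.avg (measurable_segCurve s v) (c := |s| * vSize v) fun r hr => ?_
  change vSize ((-(s * r)) • v) ≤ _
  rw [vSize_smul, abs_neg, abs_mul, abs_of_pos hr.1]
  refine mul_le_mul_of_nonneg_right ?_ (vSize_nonneg v)
  exact mul_le_of_le_one_right (abs_nonneg s) hr.2

lemma HorizLip.ell_segAvg [SFinite μ] (hu : S.HorizLip u M) (hφ : S.IsTest φ) {s : ℝ}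
    (hs : 0 < s) (v : ℝ × ℝ) :
    ∫ x, φ x * S.incr u (hExp (s • v)) x ∂μ = s * S.ell u v (S.segAvg s v φ) := by
  obtain ⟨B, hB0, hB⟩ := hφ.bdd
  have hM := hu.nonneg
  have hv := vSize_nonneg v
  have hui : ∀ g, Integrable (fun x => φ x * u (S.act x g)) μ := fun g =>
    hφ.integrable_mul (S.integrable_act g hu.integrable)
  set F : ℝ → ℝ := fun r => ∫ x, φ x * u (S.act x (hExp (r • v))) ∂μ with hF
  have hdiff : ∀ a h, F (a + h) - F a
      = ∫ x, φ x * S.incr u (hExp (h • v)) (S.act x (hExp (a • v))) ∂μ := by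
    intro a h
    simp only [hF]
    rw [← integral_sub (hui _) (hui _)]
    refine integral_congr_ae (ae_of_all _ fun x => ?_)
    simp only [incr, S.act_act, hMul_hExp_smul]
    ring
  have hLip : ∀ a b, |F a - F b| ≤ B * (M * vSize v) * |a - b| := by
    intro a b
    have e := hdiff b (a - b)
    rw [add_sub_cancel] at e
    rw [e]
    refine (abs_integral_mul_le hφ.measurable hB (S.integrable_act _
      (integrable_incr hu.integrable _))).trans ?_
    rw [S.integral_act _ (fun x => |S.incr u (hExp ((a - b) • v)) x|)]
    have := hu.osc_le ((a - b) • v)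
    rw [vSize_smul] at this
    calc _ ≤ B * (M * (|a - b| * vSize v)) := mul_le_mul_of_nonneg_left this hB0
      _ = _ := by ring
  have h0 : ∫ x, φ x * S.incr u (hExp (s • v)) x ∂μ = F s - F 0 := by
    have := hdiff 0 s
    rw [zero_add] at this
    rw [this, zero_smul, hExp_zero]
    simp only [S.act_zero]
  have key : S.ell u v (S.segAvg s v φ) = s⁻¹ * (F s - F 0) := by
    refine hu.ell_eq_of_abs_sub_le (hφ.segAvg s v) (C := 2 * (B * (M * vSize v)) / s) fun n => ?_
    have hn : (0 : ℝ) < n + 1 := by positivity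
    set h : ℝ := 1 / ((n : ℝ) + 1) with hh
    have h0 : 0 ≤ h := by positivity
    have e1 : ∫ x, S.segAvg s v φ x * S.incr u (hExp (h • v)) x ∂μ
        = ∫ r in Ioc (0 : ℝ) 1, (F (s * r + h) - F (s * r)) := by
      unfold segAvg
      rw [integral_avg_mul (measurable_segCurve s v) hφ.measurable hB
        (integrable_incr hu.integrable _)]
      refine integral_congr_ae (ae_of_all _ fun r => ?_)
      simp only
      rw [hdiff, neg_smul, ← hInv_hExp, integral_act_mul]
    have e2 := abs_integral_shift_sub_sub_le hLip hs h0
    unfold diffQ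
    rw [← hh, e1]
    have e3 : s⁻¹ * (F s - F 0) = ((n : ℝ) + 1) * (h / s * (F s - F 0)) := by
      rw [hh]; field_simp
    rw [e3, ← mul_sub, abs_mul, abs_of_pos hn]
    calc _ ≤ ((n : ℝ) + 1) * (2 * (B * (M * vSize v)) / s * h ^ 2) := by gcongr
      _ = _ := by rw [hh]; field_simp
  rw [h0, key, mul_inv_cancel_left₀ hs.ne']

end HeisAction

/-- The rotation of a planar vector by a right angle. -/
def rot (v : ℝ × ℝ) : ℝ × ℝ := (-v.2, v.1)

namespace HeisAction

variable {X : Type*} [MeasurableSpace X] {μ : Measure X} {S : HeisAction μ}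
variable {φ ψ w u : X → ℝ} {B K M : ℝ} {ι : Type*} [Fintype ι]

lemma abs_segAvg_mul_sub_le (hφ : S.IsTest φ) (hψ : S.IsTest ψ)
    (hK : ∀ x g, |φ (S.act x g) - φ x| ≤ K * hSize g) (hK0 : 0 ≤ K) (h1 : ∀ x, |ψ x| ≤ 1)
    {s : ℝ} (hs : 0 ≤ s) (hs1 : s ≤ 1) (v : ℝ × ℝ) (x : X) :
    |S.segAvg s v (fun x => φ x * ψ x) x - φ x * S.segAvg s v ψ x|
      ≤ K * (s * (vSize v + vSize v ^ 2)) := by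
  have hγ := measurable_segCurve s v
  obtain ⟨B, hB0, hB⟩ := (hφ.mul hψ).bdd
  have e : S.segAvg s v (fun x => φ x * ψ x) x - φ x * S.segAvg s v ψ x
      = ∫ r in Ioc (0 : ℝ) 1, (φ (S.act x (hExp ((-(s * r)) • v)))
        * ψ (S.act x (hExp ((-(s * r)) • v))) - φ x * ψ (S.act x (hExp ((-(s * r)) • v)))) := by
    rw [integral_sub (integrable_act_curve (S := S) hγ (hφ.mul hψ).measurable hB x)
      ((integrable_act_curve (S := S) hγ hψ.measurable h1 x).const_mul _), integral_const_mul]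
    rfl
  rw [e]
  have := norm_setIntegral_le_of_norm_le_const (μ := volume) (s := Ioc (0 : ℝ) 1)
    (f := fun r => φ (S.act x (hExp ((-(s * r)) • v)))
        * ψ (S.act x (hExp ((-(s * r)) • v))) - φ x * ψ (S.act x (hExp ((-(s * r)) • v))))
    (C := K * (s * (vSize v + vSize v ^ 2))) (by simp) fun r hr => by
      have hv := vSize_nonneg v
      have hsr : |-(s * r)| ≤ s := by
        rw [abs_neg, abs_of_nonneg (mul_nonneg hs hr.1.le)]
        exact mul_le_of_le_one_right hs hr.2
      rw [← sub_mul, Real.norm_eq_abs, abs_mul]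
      refine (mul_le_of_le_one_right (abs_nonneg _) (h1 _)).trans ((hK _ _).trans ?_)
      gcongr
      exact (hSize_hExp_smul_le (hsr.trans hs1) v).trans (by gcongr)
  simpa using this

lemma HorizLip.sum_integral_negPart_le [SFinite μ] (hu : S.HorizLip u M) {χ : ι → X → ℝ}
    (hχ : ∀ i, S.IsTest (χ i)) (v : ι → ℝ × ℝ) {η : ℝ}
    (h : ∀ ψ : ι → X → ℝ, (∀ i, S.IsTest (ψ i)) → (∀ i x, 0 ≤ ψ i x) → (∀ i x, ψ i x ≤ 1) →
      ∑ i, -S.ell u (v i) (fun x => χ i x * ψ i x) ≤ η) :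
    ∃ C, ∀ s, 0 < s → s ≤ 1 →
      ∑ i, ∫ x, χ i x * max (-S.incr u (hExp (s • v i)) x) 0 ∂μ ≤ s * η + C * s ^ 2 := by
  choose K hK0 hK using fun i => (hχ i).lip
  have hM := hu.nonneg
  refine ⟨∑ i, (K i * (vSize (v i) + vSize (v i) ^ 2) * (M * vSize (v i)) + 1),
    fun s hs hs1 => ?_⟩
  have hi := fun i => integrable_incr (S := S) hu.integrable (hExp (s • v i))
  have hm := fun i => measurable_incr (S := S) hu.measurable (hExp (s • v i))
  have hset : ∀ i, MeasurableSet {x | S.incr u (hExp (s • v i)) x < 0} := fun i =>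
    measurableSet_lt (hm i) measurable_const
  have hex := fun i => exists_isTest_approx (S := S)
    (ψ := {x | S.incr u (hExp (s • v i)) x < 0}.indicator fun _ => 1)
    (w := fun x => χ i x * S.incr u (hExp (s • v i)) x)
    (measurable_const.indicator (hset i))
    (fun x => indicator_nonneg (fun _ _ => zero_le_one) x)
    (fun x => indicator_le_self' (fun _ _ => zero_le_one) x)
    ((hχ i).integrable_mul (hi i))
    ((hu.transCont.incr hu.integrable _).test_mul (hi i) (hχ i)) (ε := s ^ 2) (by positivity)
  choose ψ hψ hψ0 hψ1 hψe using hex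
  have hψa : ∀ i x, |ψ i x| ≤ 1 := fun i x => abs_le.2 ⟨by linarith [hψ0 i x], hψ1 i x⟩
  have h2 := h (fun i => S.segAvg s (v i) (ψ i)) (fun i => (hψ i).segAvg s (v i))
    (fun i => avg_nonneg (hψ0 i)) fun i x =>
      (le_abs_self _).trans (abs_avg_le (measurable_segCurve s (v i)) (hψ i).measurable (hψa i) x)
  have key : ∀ i, ∫ x, χ i x * max (-S.incr u (hExp (s • v i)) x) 0 ∂μ
      ≤ s * -S.ell u (v i) (fun x => χ i x * S.segAvg s (v i) (ψ i) x)
        + (K i * (vSize (v i) + vSize (v i) ^ 2) * (M * vSize (v i)) + 1) * s ^ 2 := by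
    intro i
    have hv := vSize_nonneg (v i)
    have t1 : S.IsTest (S.segAvg s (v i) fun x => χ i x * ψ i x) := ((hχ i).mul (hψ i)).segAvg _ _
    have t2 : S.IsTest fun x => χ i x * S.segAvg s (v i) (ψ i) x :=
      (hχ i).mul ((hψ i).segAvg _ _)
    have e1 : ∫ x, {x | S.incr u (hExp (s • v i)) x < 0}.indicator (fun _ => (1 : ℝ)) x
        * (χ i x * S.incr u (hExp (s • v i)) x) ∂μ
        = -∫ x, χ i x * max (-S.incr u (hExp (s • v i)) x) 0 ∂μ := by
      rw [← integral_neg]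
      refine integral_congr_ae (ae_of_all _ fun x => ?_)
      by_cases hx : S.incr u (hExp (s • v i)) x < 0
      · simp only [indicator, mem_ofPred_eq, hx, if_true]
        rw [max_eq_left (by linarith)]; ring
      · simp only [indicator, mem_ofPred_eq, hx, if_false]
        rw [max_eq_right (by linarith)]; ring
    have e2 : ∫ x, ψ i x * (χ i x * S.incr u (hExp (s • v i)) x) ∂μ
        = s * S.ell u (v i) (S.segAvg s (v i) fun x => χ i x * ψ i x) := by
      rw [← hu.ell_segAvg ((hχ i).mul (hψ i)) hs]
      refine integral_congr_ae (ae_of_all _ fun x => ?_)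
      simp only; ring
    have e3 := hu.ell_sub t1 t2 (v i)
    have e4 := hu.abs_ell_le (t1.sub t2)
      (B := K i * (s * (vSize (v i) + vSize (v i) ^ 2)))
      (mul_nonneg (hK0 i) (by positivity))
      (abs_segAvg_mul_sub_le (hχ i) (hψ i) (hK i) (hK0 i) (hψa i) hs.le hs1 (v i)) (v i)
    have e5 := hψe i
    rw [e1, e2] at e5
    rw [e3] at e4
    have e6 := mul_le_mul_of_nonneg_left (abs_le.1 e4).1 hs.le
    have e7 := (abs_le.1 e5).2
    linarith
  calc _ ≤ ∑ i, (s * -S.ell u (v i) (fun x => χ i x * S.segAvg s (v i) (ψ i) x)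
        + (K i * (vSize (v i) + vSize (v i) ^ 2) * (M * vSize (v i)) + 1) * s ^ 2) :=
        Finset.sum_le_sum fun i _ => key i
    _ = s * ∑ i, -S.ell u (v i) (fun x => χ i x * S.segAvg s (v i) (ψ i) x)
        + (∑ i, (K i * (vSize (v i) + vSize (v i) ^ 2) * (M * vSize (v i)) + 1)) * s ^ 2 := by
        rw [Finset.sum_add_distrib, ← Finset.mul_sum, ← Finset.sum_mul]
    _ ≤ _ := by gcongr

variable (S) in
/-- Finite partitions of unity by test functions. -/
structure IsPartition (χ : ι → X → ℝ) : Prop where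
  isTest : ∀ i, S.IsTest (χ i)
  nonneg : ∀ i x, 0 ≤ χ i x
  sum_eq : ∀ x, ∑ i, χ i x = 1

lemma IsPartition.le_one {χ : ι → X → ℝ} (hχ : S.IsPartition χ) (i : ι) (x : X) : χ i x ≤ 1 :=
  (hχ.sum_eq x) ▸ Finset.single_le_sum (f := fun i => χ i x) (fun j _ => hχ.nonneg j x)
    (Finset.mem_univ i)

lemma HorizLip.exists_near_optimal [Nonempty ι] (hu : S.HorizLip u M) (θ : ι → ℝ × ℝ) {δ : ℝ}
    (hδ : 0 < δ) : ∃ χ : ι → X → ℝ, S.IsPartition χ ∧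
      ∀ i j, ∀ ψ, S.IsTest ψ → (∀ x, 0 ≤ ψ x) → (∀ x, ψ x ≤ 1) →
        S.ell u (θ j) (fun x => χ i x * ψ x) ≤ S.ell u (θ i) (fun x => χ i x * ψ x) + δ := by
  classical
  set V : Set ℝ := {a | ∃ χ : ι → X → ℝ, S.IsPartition χ ∧ a = ∑ i, S.ell u (θ i) (χ i)} with hV
  have hbdd : BddAbove V := by
    refine ⟨∑ i, 1 * (M * vSize (θ i)), ?_⟩
    rintro _ ⟨χ, hχ, rfl⟩
    refine Finset.sum_le_sum fun i _ => (le_abs_self _).trans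
      (hu.abs_ell_le (hχ.isTest i) zero_le_one (fun x => ?_) _)
    rw [abs_of_nonneg (hχ.nonneg i x)]
    exact hχ.le_one i x
  have hne : V.Nonempty := by
    obtain ⟨i₀⟩ := ‹Nonempty ι›
    refine ⟨_, fun i _ => if i = i₀ then 1 else 0, ⟨fun i => IsTest.const _, fun i x => ?_,
      fun x => by simp⟩, rfl⟩
    split_ifs <;> simp
  obtain ⟨_, ⟨χ, hχ, rfl⟩, hlt⟩ := exists_lt_of_lt_csSup hne (sub_lt_self (sSup V) hδ)
  refine ⟨χ, hχ, fun i j ψ hψ h0 h1 => ?_⟩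
  set f : X → ℝ := fun x => χ i x * ψ x with hf
  have hft : S.IsTest f := (hχ.isTest i).mul hψ
  set c : ι → ℝ := fun k => (if k = j then 1 else 0) - (if k = i then 1 else 0) with hc
  set χ' : ι → X → ℝ := fun k x => χ k x + c k * f x with hχ'
  have hp : S.IsPartition χ' := by
    refine ⟨fun k => (hχ.isTest k).add (hft.const_mul _), fun k x => ?_, fun x => ?_⟩
    · have f0 : 0 ≤ f x := mul_nonneg (hχ.nonneg i x) (h0 x)
      have f1 : f x ≤ χ i x := mul_le_of_le_one_right (hχ.nonneg i x) (h1 x)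
      have := hχ.nonneg k x
      simp only [hχ', hc]
      by_cases hk : k = i
      · subst hk
        simp only [if_true]
        split_ifs <;> linarith
      · simp only [hk, if_false]
        split_ifs <;> linarith
    · simp only [hχ', Finset.sum_add_distrib, ← Finset.sum_mul, hχ.sum_eq]
      simp [hc]
  have hle : ∑ k, S.ell u (θ k) (χ' k) ≤ sSup V := le_csSup hbdd ⟨χ', hp, rfl⟩
  have e : ∑ k, S.ell u (θ k) (χ' k)
      = ∑ k, S.ell u (θ k) (χ k) + (S.ell u (θ j) f - S.ell u (θ i) f) := by
    have : ∀ k, S.ell u (θ k) (χ' k) = S.ell u (θ k) (χ k) + c k * S.ell u (θ k) f := fun k => by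
      rw [hu.ell_add (hχ.isTest k) (hft.const_mul _), hu.ell_const_mul hft]
    simp only [this, Finset.sum_add_distrib, hc, sub_mul, Finset.sum_sub_distrib]
    simp
  linarith

lemma exists_fin_angle {n : ℕ} (hn : 0 < n) (k : ℤ) : ∃ j : Fin (2 * n),
    Real.cos (j * (Real.pi / n)) = Real.cos (k * (Real.pi / n)) ∧
    Real.sin (j * (Real.pi / n)) = Real.sin (k * (Real.pi / n)) := by
  have hn' : (n : ℝ) ≠ 0 := by positivity
  have h2 : (0 : ℤ) < 2 * n := by positivity
  have h0 := Int.emod_nonneg k h2.ne'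
  have h1 := Int.emod_lt_of_pos k h2
  obtain ⟨m, hm⟩ := Int.eq_ofNat_of_zero_le h0
  refine ⟨⟨m, by omega⟩, ?_⟩
  have e : (k : ℝ) * (Real.pi / n) = m * (Real.pi / n) + (k / (2 * n) : ℤ) * (2 * Real.pi) := by
    have h3 := Int.emod_add_mul_ediv k (2 * n)
    rw [hm] at h3
    have h4 : (k : ℝ) = (m : ℝ) + 2 * n * (k / (2 * n) : ℤ) := by
      have := congrArg (Int.cast : ℤ → ℝ) h3
      push_cast at this
      exact this.symm
    conv_lhs => rw [h4]
    field_simp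
  rw [e]
  exact ⟨(Real.cos_add_int_mul_two_pi _ _).symm, (Real.sin_add_int_mul_two_pi _ _).symm⟩

lemma HorizLip.sum_ell_le (hu : S.HorizLip u M) {χ : ι → X → ℝ} (hχ : S.IsPartition χ)
    {θ : ι → ℝ × ℝ} (h1 : ∀ i, |(θ i).1| ≤ 1) (h2 : ∀ i, |(θ i).2| ≤ 1) {ψ : ι → X → ℝ}
    (hψ : ∀ i, S.IsTest (ψ i)) (h0 : ∀ i x, 0 ≤ ψ i x) (h01 : ∀ i x, ψ i x ≤ 1) :
    ∑ i, S.ell u (θ i) (fun x => χ i x * ψ i x) ≤ 2 * M := by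
  have ht : ∀ i, S.IsTest fun x => χ i x * ψ i x := fun i => (hχ.isTest i).mul (hψ i)
  have hb : ∀ c : ι → ℝ, (∀ i, |c i| ≤ 1) → ∀ v, vSize v = 1 →
      ∑ i, c i * S.ell u v (fun x => χ i x * ψ i x) ≤ M := by
    intro c hc v hv
    have e := hu.ell_sum Finset.univ (fun i _ => (ht i).const_mul (c i)) v
    simp only [hu.ell_const_mul (ht _)] at e
    rw [← e]
    refine (le_abs_self _).trans ((hu.abs_ell_le (IsTest.sum _ fun i _ => (ht i).const_mul (c i))
      zero_le_one (fun x => ?_) v).trans (by rw [hv]; linarith))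
    refine (Finset.abs_sum_le_sum_abs _ _).trans ((Finset.sum_le_sum fun i _ => ?_).trans
      (hχ.sum_eq x).le)
    rw [abs_mul, abs_of_nonneg (mul_nonneg (hχ.nonneg i x) (h0 i x))]
    calc |c i| * (χ i x * ψ i x) ≤ 1 * (χ i x * 1) := by
          gcongr
          · exact mul_nonneg (hχ.nonneg i x) (h0 i x)
          · exact hc i
          · exact hχ.nonneg i x
          · exact h01 i x
      _ = _ := by ring
  have a1 := hb _ h1 (1, 0) (by simp [vSize])
  have a2 := hb _ h2 (0, 1) (by simp [vSize])
  have : ∀ i, S.ell u (θ i) (fun x => χ i x * ψ i x) = _ := fun i => hu.ell_eq (ht i) (θ i)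
  simp only [this, Finset.sum_add_distrib]
  linarith

lemma HorizLip.exists_good_partition (hu : S.HorizLip u M) {η : ℝ} (hη : 0 < η) :
    ∃ (N : ℕ) (χ : Fin N → X → ℝ) (θ : Fin N → ℝ × ℝ), S.IsPartition χ ∧
      (∀ i, (θ i).1 ^ 2 + (θ i).2 ^ 2 = 1) ∧
      ∀ ψ : Fin N → X → ℝ, (∀ i, S.IsTest (ψ i)) → (∀ i x, 0 ≤ ψ i x) → (∀ i x, ψ i x ≤ 1) →
        ∑ i, -S.ell u (θ i) (fun x => χ i x * ψ i x) ≤ η ∧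
        ∑ i, -S.ell u (rot (θ i)) (fun x => χ i x * ψ i x) ≤ η ∧
        ∑ i, -S.ell u (-rot (θ i)) (fun x => χ i x * ψ i x) ≤ η ∧
        ∑ i, -S.ell u (-θ i) (fun x => χ i x * ψ i x) ≤ 2 * M := by
  have hM := hu.nonneg
  have hpi := Real.pi_pos
  obtain ⟨n₀, hn₀⟩ := exists_nat_ge (Real.pi ^ 2 * M / η)
  set n := n₀ + 2 with hn
  have hnpos : 0 < n := by omega
  have hn' : (0 : ℝ) < n := by positivity
  have hn2 : (2 : ℝ) ≤ n := by rw [hn]; push_cast; linarith [(Nat.cast_nonneg n₀ : (0 : ℝ) ≤ n₀)]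
  set α := Real.pi / n with hα
  have hα0 : 0 < α := by positivity
  have hα1 : α ≤ Real.pi / 2 := by rw [hα]; gcongr
  have hnα : n * α = Real.pi := by rw [hα]; field_simp
  have hαM : α * M * Real.pi ≤ η := by
    have : Real.pi ^ 2 * M / η ≤ n := hn₀.trans (by rw [hn]; push_cast; linarith)
    rw [div_le_iff₀ hη] at this
    rw [hα, div_mul_eq_mul_div, div_mul_eq_mul_div, div_le_iff₀ hn']
    linarith
  have hsin : 2 / Real.pi * α ≤ Real.sin α := Real.mul_le_sin hα0.le hα1
  have hsin0 : 0 < Real.sin α := lt_of_lt_of_le (by positivity) hsin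
  have hsin1 := Real.sin_le_one α
  have hcos : (1 - Real.cos α) * (2 * M) ≤ η / 2 * Real.sin α := by
    have h1 := Real.one_sub_sq_div_two_le_cos (x := α)
    calc (1 - Real.cos α) * (2 * M) ≤ (α ^ 2 / 2) * (2 * M) := by gcongr; linarith
      _ = α * M * Real.pi * (α / Real.pi) := by field_simp
      _ ≤ η * (α / Real.pi) := by gcongr
      _ = η / 2 * (2 / Real.pi * α) := by ring
      _ ≤ _ := by gcongr
  set δ := η * Real.sin α / (2 * (2 * n)) with hδ
  have hδ0 : 0 < δ := by positivity
  let θ : Fin (2 * n) → ℝ × ℝ := fun j => (Real.cos (j * α), Real.sin (j * α))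
  have : Nonempty (Fin (2 * n)) := ⟨⟨0, by omega⟩⟩
  obtain ⟨χ, hχ, hopt⟩ := hu.exists_near_optimal θ hδ0
  refine ⟨2 * n, χ, θ, hχ, fun i => Real.cos_sq_add_sin_sq _, fun ψ hψ h0 h1 => ?_⟩
  have ht : ∀ i, S.IsTest fun x => χ i x * ψ i x := fun i => (hχ.isTest i).mul (hψ i)
  set a : Fin (2 * n) → ℝ := fun i => S.ell u (θ i) (fun x => χ i x * ψ i x) with ha
  set b : Fin (2 * n) → ℝ := fun i => S.ell u (rot (θ i)) (fun x => χ i x * ψ i x) with hb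
  have hneg : ∀ v i, S.ell u (-v) (fun x => χ i x * ψ i x)
      = -S.ell u v (fun x => χ i x * ψ i x) := by
    intro v i
    rw [hu.ell_eq (ht i) (-v), hu.ell_eq (ht i) v]
    simp only [Prod.fst_neg, Prod.snd_neg]; ring
  have hrot : ∀ (i : Fin (2 * n)) (m : ℤ),
      Real.cos (m * α) * a i + Real.sin (m * α) * b i ≤ a i + δ := by
    intro i m
    obtain ⟨j, hj1, hj2⟩ := exists_fin_angle hnpos (i + m)
    have h := hopt i j (ψ i) (hψ i) (h0 i) (h1 i)
    have e : S.ell u (θ j) (fun x => χ i x * ψ i x)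
        = Real.cos (m * α) * a i + Real.sin (m * α) * b i := by
      simp only [ha, hb]
      rw [hu.ell_eq (ht i) (θ j), hu.ell_eq (ht i) (θ i), hu.ell_eq (ht i) (rot (θ i))]
      simp only [θ, rot]
      rw [hα, hj1, hj2, ← hα]
      push_cast
      rw [add_mul, Real.cos_add, Real.sin_add]
      ring
    rw [← e]
    exact h
  have hp := fun i => hrot i 1
  have hm := fun i => hrot i (-1)
  have ho := fun i => hrot i n
  simp only [Int.cast_one, one_mul, Int.cast_neg, neg_mul, Real.cos_neg, Real.sin_neg,
    Int.cast_natCast, hnα, Real.cos_pi, Real.sin_pi, zero_mul, add_zero] at hp hm ho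
  have hsum : ∑ i, a i ≤ 2 * M := hu.sum_ell_le hχ (fun i => Real.abs_cos_le_one _)
    (fun i => Real.abs_sin_le_one _) hψ h0 h1
  have hcard : ∑ _i : Fin (2 * n), δ = η * Real.sin α / 2 := by
    simp [hδ]; field_simp
  have hcos1 : 0 ≤ 1 - Real.cos α := by linarith [Real.cos_le_one α]
  have hcs : (1 - Real.cos α) * ∑ i, a i ≤ η / 2 * Real.sin α :=
    (mul_le_mul_of_nonneg_left hsum hcos1).trans hcos
  have hη1 : η * Real.sin α ≤ η := mul_le_of_le_one_right hη.le hsin1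
  have sp := Finset.sum_le_sum fun i (_ : i ∈ Finset.univ) => hp i
  have sm := Finset.sum_le_sum fun i (_ : i ∈ Finset.univ) => hm i
  have so := Finset.sum_le_sum fun i (_ : i ∈ Finset.univ) => ho i
  simp only [Finset.sum_add_distrib, ← Finset.mul_sum, Finset.sum_neg_distrib, hcard] at sp sm so
  simp only [hneg, neg_neg, Finset.sum_neg_distrib]
  refine ⟨by linarith, ?_, ?_, hsum⟩
  · refine le_of_mul_le_mul_left ?_ hsin0
    linarith
  · refine le_of_mul_le_mul_left ?_ hsin0
    linarith

end HeisAction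

/-- The product of the exponentials of the vectors of a list, scaled by `s`. -/
def hWord (s : ℝ) : List (ℝ × ℝ) → Heis
  | [] => 0
  | v :: L => hMul (hExp (s • v)) (hWord s L)

lemma hWord_commutator {s l : ℝ} (hl : l ≠ 0) {v : ℝ × ℝ} (hv : v.1 ^ 2 + v.2 ^ 2 = 1) :
    hWord s [l • v, l⁻¹ • rot v, l • v, l⁻¹ • -rot v, (2 * l) • -v] = hCen (-s ^ 2) := by
  have h : v.1 ^ 2 = 1 - v.2 ^ 2 := by linarith
  ext
  · simp [hWord, hMul, hExp, hCen, rot]; ring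
  · simp [hWord, hMul, hExp, hCen, rot]; ring
  · simp [hWord, hMul, hExp, hCen, rot]
    field_simp
    ring_nf
    simp only [h]
    ring

namespace HeisAction

variable {X : Type*} [MeasurableSpace X] {μ : Measure X} {S : HeisAction μ}
variable {φ χ u : X → ℝ} {K M : ℝ}

variable (S) in
/-- The negative part of the increment of a function. -/
def negIncr (u : X → ℝ) (g : Heis) (x : X) : ℝ := max (-S.incr u g x) 0

lemma integrable_negIncr (hu : Integrable u μ) (g : Heis) : Integrable (S.negIncr u g) μ :=
  (integrable_incr hu g).neg.pos_part

lemma integral_abs_negIncr_le (hu : Integrable u μ) (g : Heis) :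
    ∫ x, |S.negIncr u g x| ∂μ ≤ S.osc u g := by
  refine integral_mono (integrable_negIncr hu g).abs (integrable_incr hu g).abs fun x => ?_
  simp only [negIncr]
  rw [abs_of_nonneg (le_max_right _ _)]
  exact max_le (neg_le_abs _) (abs_nonneg _)

lemma osc_eq_two_mul (hu : Integrable u μ) (g : Heis) :
    S.osc u g = 2 * ∫ x, S.negIncr u g x ∂μ := by
  have h0 : ∫ x, S.incr u g x ∂μ = 0 := by
    simp only [incr]
    rw [integral_sub (S.integrable_act g hu) hu, S.integral_act g u, sub_self]
  rw [← integral_const_mul, ← zero_add (∫ x, 2 * S.negIncr u g x ∂μ), ← h0,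
    ← integral_add (integrable_incr hu g) ((integrable_negIncr hu g).const_mul 2)]
  refine integral_congr_ae (ae_of_all _ fun x => ?_)
  simp only [negIncr]
  rcases le_total 0 (S.incr u g x) with h | h
  · rw [abs_of_nonneg h, max_eq_right (by linarith)]; ring
  · rw [abs_of_nonpos h, max_eq_left (by linarith)]; ring

lemma integral_mul_negIncr_hMul_le (hu : Integrable u μ) (hφ : S.IsTest φ) (h0 : ∀ x, 0 ≤ φ x)
    (hK : ∀ x g, |φ (S.act x g) - φ x| ≤ K * hSize g) (hK0 : 0 ≤ K) (g h : Heis) :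
    ∫ x, φ x * S.negIncr u (hMul g h) x ∂μ ≤ ∫ x, φ x * S.negIncr u g x ∂μ
      + ∫ x, φ x * S.negIncr u h x ∂μ + K * hSize (hInv g) * S.osc u h := by
  have hi := integrable_negIncr (S := S) hu
  have e := (abs_le.1 (abs_integral_mul_act_sub_le hφ hK (hi h) g)).2
  have e' : K * hSize (hInv g) * ∫ x, |S.negIncr u h x| ∂μ ≤ K * hSize (hInv g) * S.osc u h :=
    mul_le_mul_of_nonneg_left (integral_abs_negIncr_le hu h) (mul_nonneg hK0 (hSize_nonneg _))
  have h1 : ∫ x, φ x * S.negIncr u (hMul g h) x ∂μ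
      ≤ ∫ x, (φ x * S.negIncr u g x + φ x * S.negIncr u h (S.act x g)) ∂μ := by
    refine integral_mono (hφ.integrable_mul (hi _)) ((hφ.integrable_mul (hi g)).add
      (hφ.integrable_mul (S.integrable_act g (hi h)))) fun x => ?_
    simp only [← mul_add]
    refine mul_le_mul_of_nonneg_left ?_ (h0 x)
    simp only [negIncr, incr_hMul]
    refine max_le ?_ (add_nonneg (le_max_right _ _) (le_max_right _ _))
    rw [neg_add]
    exact add_le_add (le_max_left _ _) (le_max_left _ _)
  rw [integral_add (hφ.integrable_mul (hi g))
    (hφ.integrable_mul (S.integrable_act g (hi h)))] at h1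
  linarith

lemma osc_zero : S.osc u 0 = 0 := by simp [osc, incr, S.act_zero]

lemma HorizLip.osc_hWord_le (hu : S.HorizLip u M) {s : ℝ} (hs : 0 ≤ s) (L : List (ℝ × ℝ)) :
    S.osc u (hWord s L) ≤ s * (M * (L.map vSize).sum) := by
  induction L with
  | nil => simp [hWord, osc_zero]
  | cons v L ih =>
    have h1 := osc_hMul_le (S := S) hu.integrable (hExp (s • v)) (hWord s L)
    have h2 := hu.osc_smul_le hs v
    simp only [hWord, List.map_cons, List.sum_cons]
    linarith

lemma HorizLip.integral_mul_negIncr_hWord_le (hu : S.HorizLip u M) (hφ : S.IsTest φ)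
    (h0 : ∀ x, 0 ≤ φ x) (L : List (ℝ × ℝ)) : ∃ C, ∀ s, 0 < s → s ≤ 1 →
      ∫ x, φ x * S.negIncr u (hWord s L) x ∂μ
        ≤ (L.map fun v => ∫ x, φ x * S.negIncr u (hExp (s • v)) x ∂μ).sum + C * s ^ 2 := by
  obtain ⟨K, hK0, hK⟩ := hφ.lip
  induction L with
  | nil => exact ⟨0, fun s _ _ => by simp [hWord, negIncr, incr, S.act_zero]⟩
  | cons v L ih =>
    obtain ⟨C, hC⟩ := ih
    refine ⟨C + K * (vSize v + vSize v ^ 2) * (M * (L.map vSize).sum), fun s hs hs1 => ?_⟩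
    have h1 := integral_mul_negIncr_hMul_le hu.integrable hφ h0 hK hK0 (hExp (s • v)) (hWord s L)
    have h2 := hC s hs hs1
    have h3 := hu.osc_hWord_le hs.le L
    have h4 : hSize (hInv (hExp (s • v))) ≤ s * (vSize v + vSize v ^ 2) := by
      rw [hInv_hExp, ← neg_smul]
      have := hSize_hExp_smul_le (h := -s) (by rwa [abs_neg, abs_of_pos hs]) v
      rwa [abs_neg, abs_of_pos hs] at this
    have h5 : K * hSize (hInv (hExp (s • v))) * S.osc u (hWord s L)
        ≤ K * (s * (vSize v + vSize v ^ 2)) * (s * (M * (L.map vSize).sum)) := by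
      have := vSize_nonneg v
      gcongr
      exact osc_nonneg _
    simp only [hWord, List.map_cons, List.sum_cons]
    linarith

/-- The oscillation along the center of a horizontally Lipschitz function is infinitesimally
smaller than the Carnot–Carathéodory scale. -/
theorem HorizLip.osc_hCen_isLittleO [SFinite μ] (hu : S.HorizLip u M) {ε : ℝ} (hε : 0 < ε) :
    ∀ᶠ s in 𝓝[>] (0 : ℝ), S.osc u (hCen (s ^ 2)) ≤ ε * s := by
  have hM := hu.nonneg
  set l := ε / (32 * (M + 1)) with hl
  have hl0 : 0 < l := by positivity
  have hlM : 4 * l * M ≤ ε / 8 := by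
    rw [hl]
    have : 4 * (ε / (32 * (M + 1))) * M = ε / 8 * (M / (M + 1)) := by field_simp; ring
    rw [this]
    exact mul_le_of_le_one_right (by positivity) ((div_le_one (by positivity)).2 (by linarith))
  set η := ε / (8 * (2 * l + 2 * l⁻¹)) with hη
  have hη0 : 0 < η := by positivity
  have hlη : (2 * l + 2 * l⁻¹) * η = ε / 8 := by rw [hη]; field_simp
  obtain ⟨N, χ, θ, hχ, hθ, hψ⟩ := hu.exists_good_partition hη0
  obtain ⟨C₁, h1⟩ := hu.sum_integral_negPart_le hχ.isTest θ
    fun ψ a b c => (hψ ψ a b c).1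
  obtain ⟨C₂, h2⟩ := hu.sum_integral_negPart_le hχ.isTest (fun i => rot (θ i))
    fun ψ a b c => (hψ ψ a b c).2.1
  obtain ⟨C₃, h3⟩ := hu.sum_integral_negPart_le hχ.isTest (fun i => -rot (θ i))
    fun ψ a b c => (hψ ψ a b c).2.2.1
  obtain ⟨C₄, h4⟩ := hu.sum_integral_negPart_le hχ.isTest (fun i => -θ i)
    fun ψ a b c => (hψ ψ a b c).2.2.2
  choose C hC using fun i => hu.integral_mul_negIncr_hWord_le (hχ.isTest i) (hχ.nonneg i)
    [l • θ i, l⁻¹ • rot (θ i), l • θ i, l⁻¹ • -rot (θ i), (2 * l) • -θ i]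
  set D := ∑ i, C i + 2 * C₁ * l ^ 2 + C₂ * l⁻¹ ^ 2 + C₃ * l⁻¹ ^ 2 + C₄ * (2 * l) ^ 2 with hD
  have ev : ∀ c b : ℝ, 0 < b → ∀ᶠ s in 𝓝[>] (0 : ℝ), s * c < b := fun c b hb => by
    have : Tendsto (fun s : ℝ => s * c) (𝓝 0) (𝓝 0) := by
      simpa using (continuous_mul_const c).tendsto 0
    exact (this.mono_left nhdsWithin_le_nhds).eventually (gt_mem_nhds hb)
  filter_upwards [self_mem_nhdsWithin, ev 1 1 one_pos, ev l 1 one_pos, ev l⁻¹ 1 one_pos,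
    ev (2 * l) 1 one_pos, ev D (ε / 4) (by positivity)] with s hs s1 s2 s3 s4 s5
  rw [mem_Ioi] at hs
  rw [mul_one] at s1
  have key : ∀ i, ∫ x, χ i x * S.negIncr u (hCen (-s ^ 2)) x ∂μ
      ≤ (∫ x, χ i x * S.negIncr u (hExp ((s * l) • θ i)) x ∂μ
        + (∫ x, χ i x * S.negIncr u (hExp ((s * l⁻¹) • rot (θ i))) x ∂μ
        + (∫ x, χ i x * S.negIncr u (hExp ((s * l) • θ i)) x ∂μ
        + (∫ x, χ i x * S.negIncr u (hExp ((s * l⁻¹) • -rot (θ i))) x ∂μ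
        + ∫ x, χ i x * S.negIncr u (hExp ((s * (2 * l)) • -θ i)) x ∂μ))))
        + C i * s ^ 2 := by
    intro i
    have := hC i s hs s1.le
    rw [hWord_commutator hl0.ne' (hθ i)] at this
    simpa only [List.map_cons, List.map_nil, List.sum_cons, List.sum_nil, add_zero, smul_smul]
      using this
  have hsum : ∫ x, S.negIncr u (hCen (-s ^ 2)) x ∂μ
      = ∑ i, ∫ x, χ i x * S.negIncr u (hCen (-s ^ 2)) x ∂μ := by
    rw [← integral_finsetSum _ fun i _ =>
      (hχ.isTest i).integrable_mul (integrable_negIncr hu.integrable _)]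
    simp only [← Finset.sum_mul, hχ.sum_eq, one_mul]
  have tot := Finset.sum_le_sum fun i (_ : i ∈ Finset.univ) => key i
  rw [← hsum] at tot
  simp only [Finset.sum_add_distrib, ← Finset.sum_mul] at tot
  have b1 := h1 (s * l) (by positivity) s2.le
  have b2 := h2 (s * l⁻¹) (by positivity) s3.le
  have b3 := h3 (s * l⁻¹) (by positivity) s3.le
  have b4 := h4 (s * (2 * l)) (by positivity) s4.le
  rw [← osc_hInv, hInv_hCen, osc_eq_two_mul hu.integrable]
  simp only [negIncr] at tot ⊢
  have hfin : ∫ x, max (-S.incr u (hCen (-s ^ 2)) x) 0 ∂μ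
      ≤ s * ((2 * l + 2 * l⁻¹) * η) + s * (4 * l * M) + s * (s * D) := by
    rw [hD]; linarith
  have c1 : s * (4 * l * M) ≤ s * (ε / 8) := by gcongr
  have c2 : s * (s * D) ≤ s * (ε / 4) := by gcongr
  rw [hlη] at hfin
  linarith

end HeisAction

/-- The lengths of the admissible paths joining two points. -/
def pathLengths (x y : Heis) : Set ℝ :=
  { l : ℝ | ∃ c : ℝ → Heis, ∃ v₁ v₂ : ℝ → ℝ,
    (∃ K : NNReal, LipschitzOnWith K c (Icc 0 1)) ∧
    IsHorizPath c v₁ v₂ ∧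
    IntervalIntegrable (fun t => Real.sqrt (v₁ t ^ 2 + v₂ t ^ 2)) volume 0 1 ∧
    c 0 = x ∧ c 1 = y ∧ l = pathLen v₁ v₂ }

lemma pathLen_nonneg (v₁ v₂ : ℝ → ℝ) : 0 ≤ pathLen v₁ v₂ :=
  intervalIntegral.integral_nonneg zero_le_one fun _ _ => Real.sqrt_nonneg _

lemma nonneg_of_mem_pathLengths {x y : Heis} {l : ℝ} (hl : l ∈ pathLengths x y) : 0 ≤ l := by
  obtain ⟨c, v₁, v₂, -, -, -, -, -, rfl⟩ := hl
  exact pathLen_nonneg v₁ v₂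

lemma ccDist_nonneg (x y : Heis) : 0 ≤ ccDist x y :=
  Real.sInf_nonneg fun _ hl => nonneg_of_mem_pathLengths hl

lemma sqrt_sq_add_sq_le (a b : ℝ) : Real.sqrt (a ^ 2 + b ^ 2) ≤ |a| + |b| := by
  rw [Real.sqrt_le_left (by positivity)]
  nlinarith [sq_abs a, sq_abs b, abs_nonneg a, abs_nonneg b]

lemma abs_le_sqrt_sq_add_sq (a b : ℝ) : |a| ≤ Real.sqrt (a ^ 2 + b ^ 2) :=
  Real.abs_le_sqrt (by nlinarith [sq_nonneg b])

lemma ccDist_hMul_hExp_le (p : Heis) (v : ℝ × ℝ) : ccDist p (hMul p (hExp v)) ≤ vSize v := by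
  refine (csInf_le ⟨0, fun l hl => nonneg_of_mem_pathLengths hl⟩
    (?_ : Real.sqrt (v.1 ^ 2 + v.2 ^ 2) ∈ pathLengths p (hMul p (hExp v)))).trans
    (sqrt_sq_add_sq_le v.1 v.2)
  refine ⟨fun r => hMul p (hExp (r • v)), fun _ => v.1, fun _ => v.2, ?_, ?_, by simp, ?_, by simp,
    by simp [pathLen]⟩
  · have hc : ContDiff ℝ 1 (fun r : ℝ => hMul p (hExp (r • v))) := by
      simp only [hMul, hExp, Prod.smul_fst, Prod.smul_snd, smul_eq_mul]
      fun_prop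
    exact hc.locallyLipschitz.locallyLipschitzOn.exists_lipschitzOnWith_of_compact isCompact_Icc
  · refine Eventually.of_forall fun t _ => ?_
    have h1 := (hasDerivAt_id t).mul_const v.1
    have h2 := (hasDerivAt_id t).mul_const v.2
    simp only [hMul, hExp, Prod.smul_fst, Prod.smul_snd, smul_eq_mul]
    refine ⟨?_, ?_, ?_⟩
    · simpa using h1.const_add p.1
    · simpa using h2.const_add p.2.1
    · have := ((h1.mul h2).div_const 2).const_add p.2.2 |>.add (h2.const_mul p.1)
      refine (this.congr_deriv ?_).congr_of_eventuallyEq (Eventually.of_forall fun u => ?_)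
      · simp only [id_eq]
        ring
      · simp only [Pi.add_apply, Pi.mul_apply, id_eq]
  · ext <;> simp [hMul, hExp]

lemma abs_sub_le_integral {g d w : ℝ → ℝ} {K : NNReal} (hg : LipschitzOnWith K g (Icc 0 1))
    (hd : ∀ᵐ t, t ∈ Icc (0 : ℝ) 1 → HasDerivAt g (d t) t)
    (hw : ∀ᵐ t, t ∈ Icc (0 : ℝ) 1 → |d t| ≤ w t) (hw0 : ∀ t, 0 ≤ w t)
    (hwi : IntervalIntegrable w volume 0 1) {b : ℝ} (hb : b ∈ Icc (0 : ℝ) 1) :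
    |g b - g 0| ≤ ∫ t in (0 : ℝ)..1, w t := by
  have hsub : Icc 0 b ⊆ Icc (0 : ℝ) 1 := Icc_subset_Icc_right hb.2
  have hac : AbsolutelyContinuousOnInterval g 0 b :=
    LipschitzOnWith.absolutelyContinuousOnInterval (K := K)
      (by rw [uIcc_of_le hb.1]; exact hg.mono hsub)
  have hwb : IntervalIntegrable w volume 0 b := hwi.mono_set (by
    rw [uIcc_of_le hb.1, uIcc_of_le zero_le_one]; exact hsub)
  have hwc : IntervalIntegrable w volume b 1 := hwi.mono_set (by
    rw [uIcc_of_le hb.2, uIcc_of_le zero_le_one]; exact Icc_subset_Icc_left hb.1)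
  rw [← hac.integral_deriv_eq_sub, ← Real.norm_eq_abs]
  refine (intervalIntegral.norm_integral_le_of_norm_le hb.1 ?_ hwb).trans ?_
  · filter_upwards [hd, hw] with t h1 h2 ht
    have ht' : t ∈ Icc (0 : ℝ) 1 := hsub (Ioc_subset_Icc_self ht)
    rw [(h1 ht').deriv]
    exact h2 ht'
  · rw [← intervalIntegral.integral_add_adjacent_intervals hwb hwc]
    linarith [intervalIntegral.integral_nonneg (μ := volume) hb.2 fun t _ => hw0 t]

lemma abs_le_sq_of_mem_pathLengths {p : Heis} {t l : ℝ}
    (hl : l ∈ pathLengths p (hMul p (0, 0, t))) : |t| ≤ l ^ 2 := by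
  obtain ⟨c, v₁, v₂, ⟨K, hK⟩, hc, hi, h0, h1, rfl⟩ := hl
  have hx : LipschitzOnWith (1 * K) (fun u => (c u).1) (Icc 0 1) :=
    LipschitzWith.prod_fst.comp_lipschitzOnWith hK
  have hyz : LipschitzOnWith (1 * K) (fun u => (c u).2) (Icc 0 1) :=
    LipschitzWith.prod_snd.comp_lipschitzOnWith hK
  have hzy : ∃ K', LipschitzOnWith K' (fun u => (c u).2.2 - p.1 * (c u).2.1) (Icc 0 1) := by
    have hl : ContDiff ℝ 1 (fun q : ℝ × ℝ => q.2 - p.1 * q.1) := by fun_prop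
    let A : (ℝ × ℝ) →L[ℝ] ℝ :=
      ContinuousLinearMap.snd ℝ ℝ ℝ - p.1 • ContinuousLinearMap.fst ℝ ℝ ℝ
    exact ⟨_, A.lipschitz.comp_lipschitzOnWith hyz⟩
  obtain ⟨K', hK'⟩ := hzy
  have hdev : ∀ b ∈ Icc (0 : ℝ) 1, |(c b).1 - p.1| ≤ pathLen v₁ v₂ := by
    intro b hb
    have := abs_sub_le_integral hx (hc.mono fun t h ht => (h ht).1)
      (w := fun t => Real.sqrt (v₁ t ^ 2 + v₂ t ^ 2))
      (Eventually.of_forall fun t _ => abs_le_sqrt_sq_add_sq _ _)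
      (fun t => Real.sqrt_nonneg _) hi hb
    rwa [h0] at this
  have key := abs_sub_le_integral hK'
    (hc.mono fun t h ht => (h ht).2.2.sub ((h ht).2.1.const_mul p.1))
    (w := fun t => pathLen v₁ v₂ * Real.sqrt (v₁ t ^ 2 + v₂ t ^ 2))
    (Eventually.of_forall fun t ht => by
      rw [← sub_mul, abs_mul]
      have : |v₂ t| ≤ Real.sqrt (v₁ t ^ 2 + v₂ t ^ 2) := by
        rw [add_comm]; exact abs_le_sqrt_sq_add_sq _ _
      exact mul_le_mul (hdev t ht) this (abs_nonneg _) (pathLen_nonneg _ _))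
    (fun t => mul_nonneg (pathLen_nonneg _ _) (Real.sqrt_nonneg _)) (hi.const_mul _)
    (right_mem_Icc.2 zero_le_one)
  rw [intervalIntegral.integral_const_mul] at key
  have e : ((c 1).2.2 - p.1 * (c 1).2.1) - ((c 0).2.2 - p.1 * (c 0).2.1) = t := by
    rw [h0, h1]; simp [hMul]
  rw [e] at key
  rw [sq]
  exact key

lemma div_ccDist_hCen_le (p : Heis) {a t : ℝ} (ha : 0 ≤ a) (ht : t ≠ 0) :
    a / ccDist p (hMul p (0, 0, t)) ≤ a / Real.sqrt |t| := by
  rcases (pathLengths p (hMul p (0, 0, t))).eq_empty_or_nonempty with h | h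
  · have : ccDist p (hMul p (0, 0, t)) = 0 := by
      change sInf (pathLengths p (hMul p (0, 0, t))) = 0
      rw [h, Real.sInf_empty]
    rw [this, div_zero]
    positivity
  · have hpos : 0 < Real.sqrt |t| := Real.sqrt_pos.2 (abs_pos.2 ht)
    have : Real.sqrt |t| ≤ ccDist p (hMul p (0, 0, t)) :=
      le_csInf h fun l hl => (Real.sqrt_le_left (nonneg_of_mem_pathLengths hl)).2
        (abs_le_sq_of_mem_pathLengths hl)
    gcongr

/-- For a nonnegative sequence with summable integrals the values tend to zero a.e. -/
lemma ae_tendsto_zero_of_tsum_lintegral_ne_top {X : Type*} [MeasurableSpace X] {μ : Measure X}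
    {F : ℕ → X → ENNReal} (hF : ∀ n, AEMeasurable (F n) μ) (h : ∑' n, ∫⁻ x, F n x ∂μ ≠ ⊤) :
    ∀ᵐ x ∂μ, Tendsto (fun n => F n x) atTop (𝓝 0) := by
  rw [← lintegral_tsum hF] at h
  filter_upwards [ae_lt_top' (AEMeasurable.tsum hF) h] with x hx
  exact ENNReal.tendsto_atTop_zero_of_tsum_ne_top hx.ne

/-- A continuous map into `L¹` is represented by a jointly measurable function. -/
lemma exists_measurable_representative {Z Y : Type*} [TopologicalSpace Z]
    [TopologicalSpace.SeparableSpace Z] [Nonempty Z] [MeasurableSpace Z] [OpensMeasurableSpace Z]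
    [MeasurableSpace Y] {ν : Measure Y} {G : Z → Lp ℝ 1 ν} (hG : Continuous G) :
    ∃ u : Z × Y → ℝ, Measurable u ∧ ∀ p, (fun y => u (p, y)) =ᵐ[ν] G p := by
  classical
  let d := TopologicalSpace.denseSeq Z
  have hd : ∀ (n : ℕ) (p : Z), ∃ k, ‖G (d k) - G p‖ < (1 / 2 : ℝ) ^ n := by
    intro n p
    have hopen : IsOpen {q | ‖G q - G p‖ < (1 / 2 : ℝ) ^ n} :=
      isOpen_lt (by fun_prop) continuous_const
    exact (TopologicalSpace.denseRange_denseSeq Z).exists_mem_open hopen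
      ⟨p, by simp⟩
  let N : ℕ → Z → ℕ := fun n p => Nat.find (hd n p)
  have hN : ∀ n, Measurable (N n) := fun n => measurable_find (hd n) fun k =>
    (isOpen_lt (by fun_prop) continuous_const :
      IsOpen {p | ‖G (d k) - G p‖ < (1 / 2 : ℝ) ^ n}).measurableSet
  let w : ℕ → Z × Y → ℝ := fun n q => (G (d (N n q.1)) : Y → ℝ) q.2
  have hw : ∀ n, Measurable (w n) := by
    intro n
    have h : Measurable (fun q : ℕ × Y => (G (d q.1) : Y → ℝ) q.2) :=
      measurable_from_prod_countable_right fun k => L1.measurable_coeFn (G (d k))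
    exact h.comp (((hN n).comp measurable_fst).prodMk measurable_snd)
  refine ⟨fun q => limsup (fun n => w n q) atTop, Measurable.limsup hw, fun p => ?_⟩
  have hlint : ∀ n, ∫⁻ y, ‖w n (p, y) - G p y‖ₑ ∂ν ≤ ENNReal.ofReal ((1 / 2 : ℝ) ^ n) := by
    intro n
    refine (L1.ofReal_norm_sub_eq_lintegral (G (d (N n p))) (G p)).symm.trans_le ?_
    exact ENNReal.ofReal_le_ofReal (Nat.find_spec (hd n p)).le
  have hsum : ∑' n, ∫⁻ y, ‖w n (p, y) - G p y‖ₑ ∂ν ≠ ⊤ := by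
    refine ne_top_of_le_ne_top ?_ (ENNReal.tsum_le_tsum hlint)
    exact summable_geometric_two.tsum_ofReal_ne_top
  have hae := ae_tendsto_zero_of_tsum_lintegral_ne_top (fun n =>
    (((hw n).comp measurable_prodMk_left).sub
      (L1.measurable_coeFn (G p))).enorm.aemeasurable) hsum
  filter_upwards [hae] with y hy
  refine Tendsto.limsup_eq (tendsto_iff_edist_tendsto_0.2 ?_)
  simp only [edist_eq_enorm_sub]
  exact hy

lemma measurePreserving_hMul_right (g : Heis) :
    MeasurePreserving (fun p : Heis => hMul p g) volume volume := by
  refine MeasurePreserving.skew_product (g := fun a (q : ℝ × ℝ) =>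
    (q.1 + g.2.1, q.2 + g.2.2 + a * g.2.1)) (measurePreserving_add_right volume g.1)
    (by unfold Function.uncurry; fun_prop) (Eventually.of_forall fun a => ?_)
  have := (measurePreserving_add_right (volume : Measure ℝ) g.2.1).prod
    (measurePreserving_add_right (volume : Measure ℝ) (g.2.2 + a * g.2.1))
  refine Eq.trans (congrArg (fun F => Measure.map F volume) ?_) this.map_eq
  ext q <;> simp [add_assoc]

/-- The right translation action on the first factor of a product. -/
def translationAction {Y : Type*} [MeasurableSpace Y] (ν : Measure Y) [SFinite ν] :
    HeisAction ((volume : Measure Heis).prod ν) where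
  act x g := (hMul x.1 g, x.2)
  measurable_act := by unfold hMul; fun_prop
  act_act x g h := by simp [hMul_assoc]
  act_zero x := by simp [hMul]
  measurePreserving g := (measurePreserving_hMul_right g).prod (MeasurePreserving.id ν)

section Representative

variable {Y : Type*} [MeasurableSpace Y] {ν : Measure Y} [SFinite ν] {G : Heis → Lp ℝ 1 ν}
  {u : Heis × Y → ℝ}

lemma integrable_of_representative (hG : Continuous G) (hGc : HasCompactSupport G)
    (hu : Measurable u) (huG : ∀ p, (fun y => u (p, y)) =ᵐ[ν] G p) :
    Integrable u ((volume : Measure Heis).prod ν) := by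
  rw [integrable_prod_iff hu.aestronglyMeasurable]
  refine ⟨Eventually.of_forall fun p => (L1.integrable_coeFn (G p)).congr (huG p).symm, ?_⟩
  have : (fun p => ∫ y, ‖u (p, y)‖ ∂ν) = fun p => ‖G p‖ := by
    ext p
    rw [L1.norm_eq_integral_norm]
    exact integral_congr_ae ((huG p).mono fun y hy => by simp only [hy])
  rw [this]
  exact hG.norm.integrable_of_hasCompactSupport hGc.norm

lemma osc_eq_integral_norm_sub (hu : Integrable u ((volume : Measure Heis).prod ν))
    (huG : ∀ p, (fun y => u (p, y)) =ᵐ[ν] G p) (g : Heis) :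
    (translationAction ν).osc u g = ∫ p, ‖G (hMul p g) - G p‖ := by
  rw [HeisAction.osc, integral_prod _ (HeisAction.integrable_incr hu g).abs]
  refine integral_congr_ae (Eventually.of_forall fun p => ?_)
  simp only [L1.norm_eq_integral_norm]
  refine integral_congr_ae ?_
  filter_upwards [huG p, huG (hMul p g), Lp.coeFn_sub (G (hMul p g)) (G p)] with y h1 h2 h3
  simp only [h3, Pi.sub_apply, ← h1, ← h2, Real.norm_eq_abs]
  rfl

end Representative

lemma hCen_sq (s : ℝ) :
    hCen (s ^ 2) = hMul (hMul (hMul (hExp (s, 0)) (hExp (0, s))) (hExp (-s, 0))) (hExp (0, -s)) := by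
  ext <;> simp [hCen, hMul, hExp]; ring

section HorizontalContinuity

variable {E : Type*} [NormedAddCommGroup E] {f : Heis → E} {L : ℝ}

lemma norm_sub_hCen_sq_le (hL : ∀ p v, ‖f (hMul p (hExp v)) - f p‖ ≤ L * vSize v) (p : Heis)
    {s : ℝ} (hs : 0 ≤ s) : ‖f (hMul p (hCen (s ^ 2))) - f p‖ ≤ 4 * L * s := by
  rw [hCen_sq, ← hMul_assoc, ← hMul_assoc, ← hMul_assoc]
  set p₁ := hMul p (hExp (s, 0))
  set p₂ := hMul p₁ (hExp (0, s))
  set p₃ := hMul p₂ (hExp (-s, 0))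
  have h1 := hL p (s, 0)
  have h2 := hL p₁ (0, s)
  have h3 := hL p₂ (-s, 0)
  have h4 := hL p₃ (0, -s)
  simp only [vSize, abs_zero, abs_neg, add_zero, zero_add, abs_of_nonneg hs] at h1 h2 h3 h4
  have e1 := norm_sub_le_norm_sub_add_norm_sub (f (hMul p₃ (hExp (0, -s)))) (f p₃) (f p)
  have e2 := norm_sub_le_norm_sub_add_norm_sub (f p₃) (f p₂) (f p)
  have e3 := norm_sub_le_norm_sub_add_norm_sub (f p₂) (f p₁) (f p)
  linarith

lemma norm_sub_hCen_le (hL : ∀ p v, ‖f (hMul p (hExp v)) - f p‖ ≤ L * vSize v) (p : Heis)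
    (t : ℝ) : ‖f (hMul p (hCen t)) - f p‖ ≤ 4 * L * Real.sqrt |t| := by
  have hsq : Real.sqrt |t| ^ 2 = |t| := Real.sq_sqrt (abs_nonneg t)
  rcases le_total 0 t with ht | ht
  · have := norm_sub_hCen_sq_le hL p (Real.sqrt_nonneg |t|)
    rwa [hsq, abs_of_nonneg ht] at *
  · have := norm_sub_hCen_sq_le hL (hMul p (hCen t)) (Real.sqrt_nonneg |t|)
    rw [hsq, abs_of_nonpos ht] at *
    rw [norm_sub_rev]
    rwa [show hMul (hMul p (hCen t)) (hCen (-t)) = p by ext <;> simp [hMul, hCen]] at this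

lemma continuous_of_horizontal (hL : ∀ p v, ‖f (hMul p (hExp v)) - f p‖ ≤ L * vSize v) :
    Continuous f := by
  rw [continuous_iff_continuousAt]
  intro p
  have key : ∀ q, ‖f q - f p‖ ≤ 4 * L * Real.sqrt |(hMul (hInv p) q).2.2
      - (hMul (hInv p) q).1 * (hMul (hInv p) q).2.1 / 2|
      + L * vSize ((hMul (hInv p) q).1, (hMul (hInv p) q).2.1) := by
    intro q
    set g := hMul (hInv p) q with hg
    have hq : q = hMul (hMul p (hExp (g.1, g.2.1))) (hCen (g.2.2 - g.1 * g.2.1 / 2)) := by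
      rw [hMul_assoc, ← HeisAction.hMul_hExp_hCen, hg, ← hMul_assoc, hMul_hInv]
      ext <;> simp [hMul]
    have h1 := norm_sub_hCen_le hL (hMul p (hExp (g.1, g.2.1))) (g.2.2 - g.1 * g.2.1 / 2)
    rw [← hq] at h1
    have h2 := hL p (g.1, g.2.1)
    have := norm_sub_le_norm_sub_add_norm_sub (f q) (f (hMul p (hExp (g.1, g.2.1)))) (f p)
    linarith
  rw [ContinuousAt, tendsto_iff_norm_sub_tendsto_zero]
  refine squeeze_zero (fun _ => norm_nonneg _) key ?_
  have hc : Continuous (fun q : Heis => 4 * L * Real.sqrt |(hMul (hInv p) q).2.2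
      - (hMul (hInv p) q).1 * (hMul (hInv p) q).2.1 / 2|
      + L * vSize ((hMul (hInv p) q).1, (hMul (hInv p) q).2.1)) := by
    unfold hMul vSize
    fun_prop
  have := hc.tendsto p
  rwa [hInv_hMul, show 4 * L * Real.sqrt |(0 : Heis).2.2 - (0 : Heis).1 * (0 : Heis).2.1 / 2|
      + L * vSize ((0 : Heis).1, (0 : Heis).2.1) = 0 by simp [vSize]] at this

end HorizontalContinuity

/-- A cutoff function equal to one on the ball of radius `R` and vanishing outside the ball of
radius `R + 1`. -/
def cutoff (R : ℝ) (p : Heis) : ℝ := max 0 (min 1 (R + 1 - ‖p‖))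

lemma continuous_cutoff (R : ℝ) : Continuous (cutoff R) := by unfold cutoff; fun_prop

lemma cutoff_eq_one {R : ℝ} {p : Heis} (hp : ‖p‖ ≤ R) : cutoff R p = 1 := by
  rw [cutoff, min_eq_left (by linarith), max_eq_right zero_le_one]

lemma cutoff_eq_zero {R : ℝ} {p : Heis} (hp : R + 1 ≤ ‖p‖) : cutoff R p = 0 :=
  max_eq_left ((min_le_right _ _).trans (by linarith))

lemma abs_cutoff_le_one (R : ℝ) (p : Heis) : |cutoff R p| ≤ 1 := by
  rw [cutoff, abs_of_nonneg (le_max_left _ _)]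
  exact max_le zero_le_one (min_le_left _ _)

lemma abs_cutoff_sub_le (R : ℝ) (p q : Heis) : |cutoff R p - cutoff R q| ≤ ‖p - q‖ := by
  have h1 : |cutoff R p - cutoff R q| ≤ _ :=
    abs_max_sub_max_le_max 0 (min 1 (R + 1 - ‖p‖)) 0 (min 1 (R + 1 - ‖q‖))
  have h2 := abs_min_sub_min_le_max 1 (R + 1 - ‖p‖) 1 (R + 1 - ‖q‖)
  have h3 := abs_norm_sub_norm_le q p
  rw [sub_self, abs_zero, max_eq_right (abs_nonneg _)] at h1 h2
  rw [show R + 1 - ‖p‖ - (R + 1 - ‖q‖) = ‖q‖ - ‖p‖ by ring] at h2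
  rw [norm_sub_rev]
  exact h1.trans (h2.trans h3)

lemma norm_hMul_hExp_sub_le (p : Heis) {v : ℝ × ℝ} (hv : vSize v ≤ 1) :
    ‖hMul p (hExp v) - p‖ ≤ vSize v * (1 + ‖p‖) := by
  have hp := norm_fst_le p
  have h1 : |v.1| ≤ vSize v := by unfold vSize; linarith [abs_nonneg v.2]
  have h2 : |v.2| ≤ vSize v := by unfold vSize; linarith [abs_nonneg v.1]
  have h0 := mul_nonneg (vSize_nonneg v) (norm_nonneg p)
  have e : hMul p (hExp v) - p = (v.1, v.2, (v.1 / 2 + p.1) * v.2) := by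
    ext <;> simp [hMul, hExp]; ring
  rw [e, norm_prod_le_iff, norm_prod_le_iff]
  simp only [Real.norm_eq_abs, abs_mul] at *
  refine ⟨by linarith, by linarith, ?_⟩
  rw [mul_comm]
  refine mul_le_mul h2 ((abs_add_le _ _).trans ?_) (abs_nonneg _) (vSize_nonneg v)
  rw [abs_div, abs_two]
  linarith [abs_nonneg v.1]

lemma norm_le_of_norm_hMul_hExp_le {p : Heis} {v : ℝ × ℝ} (hv : vSize v ≤ 1) :
    ‖p‖ ≤ 2 * ‖hMul p (hExp v)‖ + 1 := by
  have hv' : vSize (-v) = vSize v := by simp [vSize]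
  have h := norm_hMul_hExp_sub_le (hMul p (hExp v)) (hv'.trans_le hv)
  rw [hMul_assoc, ← hInv_hExp, hMul_hInv, show hMul p 0 = p by ext <;> simp [hMul], hv'] at h
  have h1 := norm_sub_norm_le p (hMul p (hExp v))
  have h2 : vSize v * (1 + ‖hMul p (hExp v)‖) ≤ 1 * (1 + ‖hMul p (hExp v)‖) := by gcongr
  linarith

section Cutoff

variable {Y : Type*} [MeasurableSpace Y] {ν : Measure Y} {f : Heis → Lp ℝ 1 ν} {L : ℝ}

lemma hasCompactSupport_cutoff_smul (R : ℝ) (f : Heis → Lp ℝ 1 ν) :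
    HasCompactSupport (fun p => cutoff R p • f p) :=
  HasCompactSupport.intro (isCompact_closedBall (0 : Heis) (R + 1)) fun p hp => by
    rw [mem_closedBall_zero_iff, not_le] at hp
    rw [cutoff_eq_zero hp.le, zero_smul]

lemma exists_norm_cutoff_smul_sub_le (hL0 : 0 ≤ L)
    (hL : ∀ p v, ‖f (hMul p (hExp v)) - f p‖ ≤ L * vSize v) {R : ℝ} (hR : 0 ≤ R) :
    ∃ A, 0 ≤ A ∧ ∀ v, vSize v ≤ 1 → ∀ p,
      ‖cutoff R (hMul p (hExp v)) • f (hMul p (hExp v)) - cutoff R p • f p‖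
        ≤ (Metric.closedBall (0 : Heis) (2 * R + 3)).indicator (fun _ => A * vSize v) p := by
  have hfc := continuous_of_horizontal hL
  obtain ⟨B, hB⟩ := (isCompact_closedBall (0 : Heis) (2 * R + 3)).exists_bound_of_continuousOn
    hfc.continuousOn
  have hB0 : 0 ≤ B := (norm_nonneg _).trans (hB 0 (by
    rw [mem_closedBall_zero_iff, norm_zero]; linarith))
  refine ⟨L + (1 + (2 * R + 3)) * B, by positivity, fun v hv p => ?_⟩
  by_cases hp : p ∈ Metric.closedBall (0 : Heis) (2 * R + 3)
  · rw [indicator_of_mem hp]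
    have e : cutoff R (hMul p (hExp v)) • f (hMul p (hExp v)) - cutoff R p • f p
        = cutoff R (hMul p (hExp v)) • (f (hMul p (hExp v)) - f p)
          + (cutoff R (hMul p (hExp v)) - cutoff R p) • f p := by
      rw [smul_sub, sub_smul]; abel
    have hfp := hB p hp
    rw [mem_closedBall_zero_iff] at hp
    rw [e]
    refine (norm_add_le _ _).trans ?_
    rw [norm_smul, norm_smul, Real.norm_eq_abs, Real.norm_eq_abs]
    have h1 : |cutoff R (hMul p (hExp v))| * ‖f (hMul p (hExp v)) - f p‖ ≤ 1 * (L * vSize v) :=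
      mul_le_mul (abs_cutoff_le_one _ _) (hL p v) (norm_nonneg _) zero_le_one
    have h2 : |cutoff R (hMul p (hExp v)) - cutoff R p| * ‖f p‖
        ≤ (vSize v * (1 + (2 * R + 3))) * B := by
      have h3 : vSize v * (1 + ‖p‖) ≤ vSize v * (1 + (2 * R + 3)) :=
        mul_le_mul_of_nonneg_left (by linarith) (vSize_nonneg v)
      exact mul_le_mul (((abs_cutoff_sub_le _ _ _).trans (norm_hMul_hExp_sub_le p hv)).trans h3)
        hfp (norm_nonneg _) (mul_nonneg (vSize_nonneg v) (by linarith))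
    linarith
  · rw [indicator_of_notMem hp]
    rw [mem_closedBall_zero_iff, not_le] at hp
    have := norm_le_of_norm_hMul_hExp_le (p := p) hv
    rw [cutoff_eq_zero (p := p) (by linarith), cutoff_eq_zero (p := hMul p (hExp v)) (by linarith)]
    simp

lemma integrable_norm_sub_of_hasCompactSupport {G : Heis → Lp ℝ 1 ν} (hG : Continuous G)
    (hGc : HasCompactSupport G) (g : Heis) :
    Integrable (fun p => ‖G (hMul p g) - G p‖) volume := by
  have hi : Integrable (fun p => ‖G p‖) volume := hG.norm.integrable_of_hasCompactSupport hGc.norm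
  have hm : Continuous (fun p => hMul p g) := by unfold hMul; fun_prop
  refine (((measurePreserving_hMul_right g).integrable_comp_of_integrable hi).add hi).mono'
    ((hG.comp hm).sub hG).norm.aestronglyMeasurable (Eventually.of_forall fun p => ?_)
  rw [norm_norm]
  exact norm_sub_le _ _

/-- The integrated central increments of a truncated horizontally Lipschitz map into `L¹` are of
smaller order than the horizontal scale. -/
lemma integral_norm_cutoff_smul_sub_isLittleO [SFinite ν] (hL0 : 0 ≤ L)
    (hL : ∀ p v, ‖f (hMul p (hExp v)) - f p‖ ≤ L * vSize v) {R : ℝ} (hR : 0 ≤ R)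
    {ε : ℝ} (hε : 0 < ε) :
    ∀ᶠ s in 𝓝[>] (0 : ℝ), ∫ p, ‖cutoff R (hMul p (hCen (s ^ 2))) • f (hMul p (hCen (s ^ 2)))
      - cutoff R p • f p‖ ≤ ε * s := by
  set G : Heis → Lp ℝ 1 ν := fun p => cutoff R p • f p with hGdef
  have hG : Continuous G := (continuous_cutoff R).smul (continuous_of_horizontal hL)
  have hGc : HasCompactSupport G := hasCompactSupport_cutoff_smul R f
  obtain ⟨u, hum, huG⟩ := exists_measurable_representative hG
  have hui := integrable_of_representative hG hGc hum huG
  have hosc := osc_eq_integral_norm_sub hui huG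
  obtain ⟨A, hA0, hA⟩ := exists_norm_cutoff_smul_sub_le hL0 hL hR
  set V := volume.real (Metric.closedBall (0 : Heis) (2 * R + 3))
  have hV : 0 ≤ V := measureReal_nonneg
  have hI : 0 ≤ ∫ p, ‖G p‖ := integral_nonneg fun _ => norm_nonneg _
  have hGi : Integrable (fun p => ‖G p‖) volume :=
    hG.norm.integrable_of_hasCompactSupport hGc.norm
  have hu : (translationAction ν).HorizLip u (V * A + 2 * ∫ p, ‖G p‖) := by
    refine ⟨by positivity, hum, hui, fun v => ?_⟩
    rw [hosc]
    have hv0 := vSize_nonneg v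
    rcases le_total (vSize v) 1 with hv | hv
    · have hb : ∫ p, ‖G (hMul p (hExp v)) - G p‖ ≤ V * (A * vSize v) := by
        refine (integral_mono_of_nonneg (Eventually.of_forall fun _ => norm_nonneg _) ?_
          (Eventually.of_forall (hA v hv))).trans_eq ?_
        · exact (integrable_indicator_iff Metric.isClosed_closedBall.measurableSet).2
            (integrableOn_const (measure_closedBall_lt_top.ne))
        · rw [integral_indicator_const _ Metric.isClosed_closedBall.measurableSet, smul_eq_mul]
      nlinarith [mul_nonneg hI hv0]
    · have hm := measurePreserving_hMul_right (hExp v)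
      have hGi' := hm.integrable_comp_of_integrable hGi
      have hb : ∫ p, ‖G (hMul p (hExp v)) - G p‖ ≤ 2 * ∫ p, ‖G p‖ := by
        calc ∫ p, ‖G (hMul p (hExp v)) - G p‖
            ≤ ∫ p, (‖G (hMul p (hExp v))‖ + ‖G p‖) :=
              integral_mono (integrable_norm_sub_of_hasCompactSupport hG hGc _)
                (hGi'.add hGi) fun p => norm_sub_le _ _
          _ = (∫ p, ‖G (hMul p (hExp v))‖) + ∫ p, ‖G p‖ := integral_add hGi' hGi
          _ = 2 * ∫ p, ‖G p‖ := by
              have : ∫ p, ‖G (hMul p (hExp v))‖ = ∫ p, ‖G p‖ := by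
                have h := integral_map hm.measurable.aemeasurable (f := fun p => ‖G p‖)
                  (by rw [hm.map_eq]; exact hGi.aestronglyMeasurable)
                rw [hm.map_eq] at h
                exact h.symm
              rw [this, two_mul]
      nlinarith [mul_nonneg hV hA0]
  filter_upwards [hu.osc_hCen_isLittleO hε] with s hs
  rwa [hosc] at hs

lemma exists_seq_integral_le [SFinite ν] (hL0 : 0 ≤ L)
    (hL : ∀ p v, ‖f (hMul p (hExp v)) - f p‖ ≤ L * vSize v) {R : ℝ} (hR : 0 ≤ R) :
    ∃ s : ℕ → ℝ, (∀ n, 0 < s n) ∧ Tendsto s atTop (𝓝 0) ∧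
      ∀ n, ∫ p, ‖cutoff R (hMul p (hCen (s n ^ 2))) • f (hMul p (hCen (s n ^ 2)))
        - cutoff R p • f p‖ ≤ (1 / 2) ^ n * s n := by
  have h : ∀ n : ℕ, ∃ s : ℝ, s ∈ Ioo (0 : ℝ) ((1 / 2) ^ n) ∧
      ∫ p, ‖cutoff R (hMul p (hCen (s ^ 2))) • f (hMul p (hCen (s ^ 2)))
        - cutoff R p • f p‖ ≤ (1 / 2) ^ n * s := fun n =>
    ((eventually_mem_set.2 (Ioo_mem_nhdsGT (by positivity : (0 : ℝ) < (1 / 2) ^ n))).and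
      (integral_norm_cutoff_smul_sub_isLittleO hL0 hL hR (by positivity))).exists
  choose s hs hs' using h
  exact ⟨s, fun n => (hs n).1, squeeze_zero (fun n => (hs n).1.le) (fun n => (hs n).2.le)
    (tendsto_pow_atTop_nhds_zero_of_lt_one (by norm_num) (by norm_num)), hs'⟩

lemma ae_exists_seq_tendsto [SFinite ν] (hL0 : 0 ≤ L)
    (hL : ∀ p v, ‖f (hMul p (hExp v)) - f p‖ ≤ L * vSize v) :
    ∀ᵐ p ∂(volume : Measure Heis), ∃ s : ℕ → ℝ, (∀ n, 0 < s n) ∧ Tendsto s atTop (𝓝 0) ∧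
      Tendsto (fun n => ‖f (hMul p (hCen (s n ^ 2))) - f p‖ / s n) atTop (𝓝 0) := by
  have hfc := continuous_of_horizontal hL
  have key : ∀ R : ℕ, ∀ᵐ p ∂(volume : Measure Heis), ‖p‖ < R →
      ∃ s : ℕ → ℝ, (∀ n, 0 < s n) ∧ Tendsto s atTop (𝓝 0) ∧
      Tendsto (fun n => ‖f (hMul p (hCen (s n ^ 2))) - f p‖ / s n) atTop (𝓝 0) := by
    intro R
    obtain ⟨s, hs0, hs, hsi⟩ := exists_seq_integral_le hL0 hL (Nat.cast_nonneg R)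
    set G : Heis → Lp ℝ 1 ν := fun p => cutoff R p • f p with hGdef
    have hG : Continuous G := (continuous_cutoff R).smul hfc
    have hGi := integrable_norm_sub_of_hasCompactSupport hG (hasCompactSupport_cutoff_smul R f)
    have hsum : ∑' n, ∫⁻ p, ENNReal.ofReal (‖G (hMul p (hCen (s n ^ 2))) - G p‖ / s n) ≠ ⊤ := by
      refine ne_top_of_le_ne_top summable_geometric_two.tsum_ofReal_ne_top
        (ENNReal.tsum_le_tsum fun n => ?_)
      rw [← ofReal_integral_eq_lintegral_ofReal ((hGi _).div_const _)
        (Eventually.of_forall fun p => div_nonneg (norm_nonneg _) (hs0 n).le), integral_div]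
      exact ENNReal.ofReal_le_ofReal ((div_le_iff₀ (hs0 n)).2 (hsi n))
    filter_upwards [ae_tendsto_zero_of_tsum_lintegral_ne_top
      (fun n => ((hGi _).div_const _).aemeasurable.ennreal_ofReal) hsum] with p hp hpR
    refine ⟨s, hs0, hs, ?_⟩
    have hlim := (ENNReal.tendsto_toReal ENNReal.zero_ne_top).comp hp
    refine hlim.congr' ?_
    have hc : Continuous fun r : ℝ => hMul p (hCen (r ^ 2)) := by unfold hMul hCen; fun_prop
    have hnear : ∀ᶠ n in atTop, ‖hMul p (hCen (s n ^ 2))‖ < R := by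
      have h0 := ((hc.norm.tendsto 0).comp hs)
      refine h0.eventually_lt_const ?_
      rwa [show hMul p (hCen (0 ^ 2)) = p by ext <;> simp [hMul, hCen]]
    filter_upwards [hnear] with n hn
    rw [Function.comp_apply, ENNReal.toReal_ofReal (div_nonneg (norm_nonneg _) (hs0 n).le)]
    simp only [hGdef]
    rw [cutoff_eq_one hn.le, cutoff_eq_one hpR.le, one_smul, one_smul]
  filter_upwards [ae_all_iff.2 key] with p hp
  obtain ⟨R, hR⟩ := exists_nat_gt ‖p‖
  exact hp R hR

end Cutoff

/-- For a Lipschitz map `f : H → L¹`, for a.e. `p ∈ H`,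
`liminf_{t→0} ‖f(p) - f(p·exp(tZ))‖₁ / d(p, p·exp(tZ)) = 0`. -/
theorem statement2 {Y : Type*} [MeasurableSpace Y] (ν : Measure Y) [SigmaFinite ν]
    (f : Heis → Lp ℝ 1 ν) (C : ℝ)
    (hf : ∀ x y : Heis, ‖f x - f y‖ ≤ C * ccDist x y) :
    ∀ᵐ p ∂(volume : Measure Heis),
      Filter.liminf
        (fun t : ℝ =>
          ‖f p - f (hMul p (0, 0, t))‖ / ccDist p (hMul p (0, 0, t)))
        (𝓝[≠] (0 : ℝ)) = 0 := by
  have hL : ∀ p v, ‖f (hMul p (hExp v)) - f p‖ ≤ |C| * vSize v := by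
    intro p v
    rw [norm_sub_rev]
    calc ‖f p - f (hMul p (hExp v))‖ ≤ C * ccDist p (hMul p (hExp v)) := hf _ _
      _ ≤ |C| * vSize v := mul_le_mul (le_abs_self C) (ccDist_hMul_hExp_le p v)
          (ccDist_nonneg _ _) (abs_nonneg C)
  filter_upwards [ae_exists_seq_tendsto (abs_nonneg C) hL] with p ⟨s, hs0, hs, hlim⟩
  set F : ℝ → ℝ := fun t => ‖f p - f (hMul p (0, 0, t))‖ / ccDist p (hMul p (0, 0, t))
  have hF0 : ∀ t, 0 ≤ F t := fun t => div_nonneg (norm_nonneg _) (ccDist_nonneg _ _)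
  have hFC : ∀ t, F t ≤ |C| := fun t => div_le_of_le_mul₀ (ccDist_nonneg _ _) (abs_nonneg C)
    ((hf _ _).trans (mul_le_mul_of_nonneg_right (le_abs_self C) (ccDist_nonneg _ _)))
  have hbdd : IsBoundedUnder (· ≥ ·) (𝓝[≠] (0 : ℝ)) F :=
    isBoundedUnder_of ⟨0, hF0⟩
  have hcobdd : IsCoboundedUnder (· ≥ ·) (𝓝[≠] (0 : ℝ)) F :=
    (isBoundedUnder_of ⟨|C|, hFC⟩ : IsBoundedUnder (· ≤ ·) (𝓝[≠] (0 : ℝ)) F).isCoboundedUnder_ge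
  have hFs : ∀ n, F (s n ^ 2) ≤ ‖f (hMul p (hCen (s n ^ 2))) - f p‖ / s n := by
    intro n
    refine (div_ccDist_hCen_le p (norm_nonneg _) (pow_ne_zero 2 (hs0 n).ne')).trans_eq ?_
    rw [abs_of_nonneg (sq_nonneg _), Real.sqrt_sq (hs0 n).le, norm_sub_rev, hCen]
  have hs2 : Tendsto (fun n => s n ^ 2) atTop (𝓝[≠] 0) :=
    tendsto_nhdsWithin_iff.2 ⟨by simpa using hs.pow 2,
      Eventually.of_forall fun n => pow_ne_zero 2 (hs0 n).ne'⟩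
  refine le_antisymm (le_of_forall_pos_le_add fun ε hε => ?_)
    (le_liminf_of_le hcobdd (Eventually.of_forall hF0))
  rw [zero_add]
  refine liminf_le_of_frequently_le (hs2.frequently (Eventually.frequently ?_)) hbdd
  filter_upwards [hlim.eventually_lt_const hε] with n hn
  exact (hFs n).trans hn.le
end
end

section
/- Let c = (c₁,c₂,c₃) : [0,1] → H be a C¹ horizontal path (i.e. c₃'(t) = c₁(t)·c₂'(t) for all t) whose projection π∘c = (c₁,c₂) : [0,1] → ℝ² is a closed loop. Then c(0) and c(1) lie in the same fiber of π, and c(1) = c(0)·(0,0,A), where A = ∫₀¹ c₁(t)·c₂'(t) dt is the signed Euclidean area enclosed by the loop (c₁,c₂). -/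
open MeasureTheory Set Topology Filter

noncomputable section

/-- If a C¹ horizontal path `c = (c₁,c₂,c₃)` in the Heisenberg group projects to a
closed loop in `ℝ²`, then `c(0)` and `c(1)` lie in the same fiber of `π` and
`c(1) = c(0)·(0,0,A)` where `A = ∫₀¹ c₁·c₂'` is the signed area enclosed by the loop. -/
theorem statement3 (c₁ c₂ c₃ d₁ d₂ : ℝ → ℝ)
    (h₁ : ∀ t ∈ Icc (0 : ℝ) 1, HasDerivAt c₁ (d₁ t) t)
    (h₂ : ∀ t ∈ Icc (0 : ℝ) 1, HasDerivAt c₂ (d₂ t) t)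
    (h₃ : ∀ t ∈ Icc (0 : ℝ) 1, HasDerivAt c₃ (c₁ t * d₂ t) t)
    (hd₁ : ContinuousOn d₁ (Icc (0 : ℝ) 1)) (hd₂ : ContinuousOn d₂ (Icc (0 : ℝ) 1))
    (hloop : c₁ 0 = c₁ 1 ∧ c₂ 0 = c₂ 1) :
    hPi (c₁ 0, c₂ 0, c₃ 0) = hPi (c₁ 1, c₂ 1, c₃ 1) ∧
    (c₁ 1, c₂ 1, c₃ 1) =
      hMul (c₁ 0, c₂ 0, c₃ 0) (0, 0, ∫ t in (0 : ℝ)..1, c₁ t * d₂ t) := by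
  have hint : IntervalIntegrable (fun t => c₁ t * d₂ t) volume 0 1 := by
    have hc₁ : ContinuousOn c₁ (Icc 0 1) := HasDerivAt.continuousOn h₁
    exact (hc₁.mul hd₂).intervalIntegrable_of_Icc zero_le_one
  have hftc : ∫ t in (0 : ℝ)..1, c₁ t * d₂ t = c₃ 1 - c₃ 0 :=
    intervalIntegral.integral_eq_sub_of_hasDerivAt
      (fun t ht => h₃ t (by rwa [uIcc_of_le zero_le_one] at ht)) hint
  simp [hPi, hMul, hftc, hloop.1, hloop.2]
end
end

section
/- Let f = (f₁,…,f_n) : ℝ → ℝⁿ be a continuous map, where ℝⁿ carries the ℓ¹ norm ‖x‖₁ = Σᵢ|xᵢ|. Then f is a weakly monotone parametrization of a geodesic — that is, ‖f(a) − f(c)‖₁ = ‖f(a) − f(b)‖₁ + ‖f(b) − f(c)‖₁ for all a ≤ b ≤ c in ℝ — if and only if each component function fᵢ : ℝ → ℝ is weakly monotone (nondecreasing or nonincreasing). -/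
theorem abs_sub_eq_add_iff_mem_uIcc (x y z : ℝ) :
    |x - z| = |x - y| + |y - z| ↔ y ∈ Set.uIcc x z := by
  rw [Set.mem_uIcc]
  grind

theorem monotone_or_antitone_iff_abs_sub_eq_add (g : ℝ → ℝ) :
    Monotone g ∨ Antitone g ↔
      ∀ a b c : ℝ, a ≤ b → b ≤ c → |g a - g c| = |g a - g b| + |g b - g c| := by
  simp only [Set.monotone_or_antitone_iff_uIcc, abs_sub_eq_add_iff_mem_uIcc]
  refine ⟨fun h a b c hab hbc => h a c b (Set.mem_uIcc_of_le hab hbc), fun h a c b hb => ?_⟩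
  rcases Set.mem_uIcc.mp hb with ⟨hab, hbc⟩ | ⟨hcb, hba⟩
  · exact h a b c hab hbc
  · exact Set.uIcc_comm (g c) (g a) ▸ h c b a hcb hba

open Set

/-- A continuous map `f : ℝ → (ℝⁿ, ℓ¹)` is a weakly monotone parametrization of a
geodesic iff each component is weakly monotone. -/
theorem statement6 (n : ℕ) (f : ℝ → (Fin n → ℝ)) (hf : Continuous f) :
    (∀ a b c : ℝ, a ≤ b → b ≤ c →
        ∑ i, |f a i - f c i| = ∑ i, |f a i - f b i| + ∑ i, |f b i - f c i|) ↔
      (∀ i : Fin n, Monotone (fun t => f t i) ∨ Antitone (fun t => f t i)) := by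
  simp only [monotone_or_antitone_iff_abs_sub_eq_add, ← Finset.sum_add_distrib]
  have key (a b c : ℝ) : ∑ i, |f a i - f c i| = ∑ i, (|f a i - f b i| + |f b i - f c i|) ↔
      ∀ i, |f a i - f c i| = |f a i - f b i| + |f b i - f c i| := by
    simpa using Finset.sum_eq_sum_iff_of_le (s := Finset.univ)
      fun i _ => abs_sub_le (f a i) (f b i) (f c i)
  simp only [key]
  exact ⟨fun h i a b c hab hbc => h a b c hab hbc i, fun h a b c hab hbc i => h i a b c hab hbc⟩
end
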